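/- Theorem 3.2(iii) (sublinear convergence for Łojasiewicz exponent in (1/2, 1)): Under the stated assumptions (a)–(e) and the Łojasiewicz assumption with exponent α ∈ (1/2, 1), there exist k₀ ≥ 0 and ξ > 0 such that for all k > k₀, dist((U^k, V^k, λ^k), 𝒲) ≤ ξ (k − k₀)^{−(1−α)/(2α−1)}, where 𝒲 is the set of KKT points of the penalized problem and dist denotes the distance induced by the Frobenius/Euclidean norm on triples. -/

import Mathlib

open Matrix
open scoped BigOperators

noncomputable section

/-- Frobenius inner product of two real matrices. -/
def frobInner {α β : Type*} [Fintype α] [Fintype β] (X Y : Matrix α β ℝ) : ℝ :=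
  ∑ i, ∑ j, X i j * Y i j

/-- Frobenius norm of a real matrix. -/
def frobNorm {α β : Type*} [Fintype α] [Fintype β] (X : Matrix α β ℝ) : ℝ :=
  Real.sqrt (∑ i, ∑ j, (X i j) ^ 2)

/-- Euclidean norm of a real vector. -/
def vecNorm {α : Type*} [Fintype α] (v : α → ℝ) : ℝ :=
  Real.sqrt (∑ i, (v i) ^ 2)

/-- The linear map `𝒜(X) = (⟨A 1, X⟩, …, ⟨A m, X⟩)`. -/
def Aop {n m : ℕ} (A : Fin m → Matrix (Fin n) (Fin n) ℝ)
    (X : Matrix (Fin n) (Fin n) ℝ) : Fin m → ℝ :=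
  fun i => frobInner (A i) X

/-- `s_A = Σ_i ‖A_i‖_F²`. -/
def sA {n m : ℕ} (A : Fin m → Matrix (Fin n) (Fin n) ℝ) : ℝ :=
  ∑ i, (frobNorm (A i)) ^ 2

/-- `(U, V, λ)` is an ε-KKT point of the penalized problem
`min f(UVᵀ) + (γ/2)‖U-V‖² s.t. 𝒜(UVᵀ) = b`, where `grad` denotes the gradient of `f`. -/
def IsPenEpsKKT {n m r : ℕ} (grad : Matrix (Fin n) (Fin n) ℝ → Matrix (Fin n) (Fin n) ℝ)
    (A : Fin m → Matrix (Fin n) (Fin n) ℝ) (b : Fin m → ℝ) (γ ε : ℝ)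
    (U V : Matrix (Fin n) (Fin r) ℝ) (lam : Fin m → ℝ) : Prop :=
  frobNorm (grad (U * Vᵀ) * V + γ • (U - V) + ∑ i, lam i • (A i * V)) ≤ ε ∧
  frobNorm (grad (V * Uᵀ) * U + γ • (V - U) + ∑ i, lam i • (A i * U)) ≤ ε ∧
  vecNorm (fun i => Aop A (U * Vᵀ) i - b i) ≤ ε

/-- `(U, λ)` is an ε-KKT point of the Burer–Monteiro problem
`min f(UUᵀ) s.t. 𝒜(UUᵀ) = b`, where `grad` denotes the gradient of `f`. -/
def IsBMEpsKKT {n m r : ℕ} (grad : Matrix (Fin n) (Fin n) ℝ → Matrix (Fin n) (Fin n) ℝ)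
    (A : Fin m → Matrix (Fin n) (Fin n) ℝ) (b : Fin m → ℝ) (ε : ℝ)
    (U : Matrix (Fin n) (Fin r) ℝ) (lam : Fin m → ℝ) : Prop :=
  frobNorm ((2 : ℝ) • (grad (U * Uᵀ) * U) + ∑ i, lam i • (A i * U)) ≤ ε ∧
  vecNorm (fun i => Aop A (U * Uᵀ) i - b i) ≤ ε

/-- The augmented Lagrangian `L_ρ(U,V,λ)` of the penalized problem. -/
def augL {n m r : ℕ} (f : Matrix (Fin n) (Fin n) ℝ → ℝ)
    (A : Fin m → Matrix (Fin n) (Fin n) ℝ) (b : Fin m → ℝ) (ρ γ : ℝ)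
    (U V : Matrix (Fin n) (Fin r) ℝ) (lam : Fin m → ℝ) : ℝ :=
  f (U * Vᵀ) + γ / 2 * (frobNorm (U - V)) ^ 2
    + ∑ i, lam i * (Aop A (U * Vᵀ) i - b i)
    + ρ / 2 * (vecNorm (fun i => Aop A (U * Vᵀ) i - b i)) ^ 2

/-- The level set `S_β` of the penalty function. -/
def Sset {n m r : ℕ} (f : Matrix (Fin n) (Fin n) ℝ → ℝ)
    (A : Fin m → Matrix (Fin n) (Fin n) ℝ) (b : Fin m → ℝ) (ρ₀ β : ℝ) :
    Set (Matrix (Fin n) (Fin r) ℝ × Matrix (Fin n) (Fin r) ℝ) :=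
  {p | f (p.1 * p.2ᵀ) + ρ₀ / 2 * (frobNorm (p.1 - p.2)) ^ 2
      + ρ₀ / 2 * (vecNorm (fun i => Aop A (p.1 * p.2ᵀ) i - b i)) ^ 2 ≤ β}

/-- `𝒞(U)`: the `nr × m` matrix whose `i`-th column is the vectorization of `A_i U`. -/
def Cmat {n m r : ℕ} (A : Fin m → Matrix (Fin n) (Fin n) ℝ)
    (U : Matrix (Fin n) (Fin r) ℝ) : Matrix (Fin n × Fin r) (Fin m) ℝ :=
  Matrix.of fun p i => (A i * U) p.1 p.2

/-- Smallest singular value of a real matrix, as the infimum of `‖Mx‖` over unit vectors. -/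
def sigmaMin {α β : Type*} [Fintype α] [Fintype β] (M : Matrix α β ℝ) : ℝ :=
  sInf {s | ∃ x : β → ℝ, vecNorm x = 1 ∧ s = vecNorm (M.mulVec x)}

/-- Norm of the full gradient of the augmented Lagrangian at `(U, V, λ)`
(for symmetric `f`, with `grad` the gradient of `f`). -/
def gradAugLNorm {n m r : ℕ} (grad : Matrix (Fin n) (Fin n) ℝ → Matrix (Fin n) (Fin n) ℝ)
    (A : Fin m → Matrix (Fin n) (Fin n) ℝ) (b : Fin m → ℝ) (ρ γ : ℝ)
    (U V : Matrix (Fin n) (Fin r) ℝ) (lam : Fin m → ℝ) : ℝ :=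
  Real.sqrt
    ((frobNorm (grad (U * Vᵀ) * V + γ • (U - V)
        + ∑ i, (lam i + ρ * (Aop A (U * Vᵀ) i - b i)) • (A i * V))) ^ 2
      + (frobNorm (grad (V * Uᵀ) * U + γ • (V - U)
        + ∑ i, (lam i + ρ * (Aop A (U * Vᵀ) i - b i)) • (A i * U))) ^ 2
      + (vecNorm (fun i => Aop A (U * Vᵀ) i - b i)) ^ 2)

/-- Distance between two primal-dual triples, induced by the Frobenius/Euclidean norms. -/
def tripDist {n m r : ℕ}
    (p q : Matrix (Fin n) (Fin r) ℝ × Matrix (Fin n) (Fin r) ℝ × (Fin m → ℝ)) : ℝ :=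
  Real.sqrt ((frobNorm (p.1 - q.1)) ^ 2 + (frobNorm (p.2.1 - q.2.1)) ^ 2
    + (vecNorm (fun i => p.2.2 i - q.2.2 i)) ^ 2)

/-- The set `𝒲` of KKT points of the penalized problem. -/
def KKTset {n m : ℕ} (r : ℕ) (grad : Matrix (Fin n) (Fin n) ℝ → Matrix (Fin n) (Fin n) ℝ)
    (A : Fin m → Matrix (Fin n) (Fin n) ℝ) (b : Fin m → ℝ) (γ : ℝ) :
    Set (Matrix (Fin n) (Fin r) ℝ × Matrix (Fin n) (Fin r) ℝ × (Fin m → ℝ)) :=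
  {p | IsPenEpsKKT grad A b γ 0 p.1 p.2.1 p.2.2}

/-- A biconvex problem in two blocks of variables with a bilinear constraint `B U V = b`, together
with the constants governing its penalty level set. -/
structure BilinearProblem (E H : Type*) [NormedAddCommGroup E] [InnerProductSpace ℝ E]
    [NormedAddCommGroup H] [InnerProductSpace ℝ H] where
  φ : E → E → ℝ
  G : E → E → E
  B : E →ₗ[ℝ] E →ₗ[ℝ] H
  T : H →ₗ[ℝ] E →ₗ[ℝ] E
  b : H
  (ρ γ ρ₀ δ Lf L η s β₀ β : ℝ)
  φ_symm : ∀ U V, φ U V = φ V U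
  φ_convex : ∀ U, ConvexOn ℝ Set.univ (φ U)
  φ_cont : Continuous fun p : E × E => φ p.1 p.2
  φ_scale : ∀ (c : ℝ) U V, c ≠ 0 → φ (c • U) (c⁻¹ • V) = φ U V
  φ_deriv : ∀ U V D, HasDerivAt (fun t : ℝ => φ U (V + t • D)) (inner ℝ (G U V) D) 0
  G_cont : Continuous fun p : E × E => G p.1 p.2
  B_symm : ∀ U V, B U V = B V U
  B_cont : Continuous fun p : E × E => B p.1 p.2
  T_cont : Continuous fun p : H × E => T p.1 p.2
  T_adj : ∀ μ U V, inner ℝ (T μ U) V = inner ℝ μ (B U V)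
  T_le : ∀ μ U, ‖T μ U‖ ≤ s * ‖μ‖ * ‖U‖
  ρ_pos : 0 < ρ
  γ_pos : 0 < γ
  ρ₀_pos : 0 < ρ₀
  δ_pos : 0 < δ
  Lf_pos : 0 < Lf
  L_pos : 0 < L
  η_pos : 0 < η
  s_nonneg : 0 ≤ s
  ρ₀_lt : ρ₀ < γ
  ρ_big : 2 * ρ₀ < ρ
  level_compact : ∀ c, IsCompact {p : E × E |
    φ p.1 p.2 + ρ₀ / 2 * ‖p.1 - p.2‖ ^ 2 + ρ₀ / 2 * ‖B p.1 p.2 - b‖ ^ 2 ≤ c}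
  level_norm : ∀ U V,
    φ U V + ρ₀ / 2 * ‖U - V‖ ^ 2 + ρ₀ / 2 * ‖B U V - b‖ ^ 2 ≤ β → ‖U‖ ≤ δ ∧ ‖V‖ ≤ δ
  level_sing : ∀ U V,
    φ U V + ρ₀ / 2 * ‖U - V‖ ^ 2 + ρ₀ / 2 * ‖B U V - b‖ ^ 2 ≤ β → ∀ μ, η * ‖μ‖ ≤ ‖T μ U‖
  G_lip : ∀ U V U' V', ‖U‖ * ‖V‖ ≤ δ ^ 2 → ‖U'‖ * ‖V'‖ ≤ δ ^ 2 →
    ‖G U' V' - G U V‖ ≤ L * ‖U'‖ * (‖U'‖ * ‖V' - V‖ + ‖V‖ * ‖U' - U‖) + Lf * ‖U' - U‖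
  G_le : ∀ U V, ‖U‖ * ‖V‖ ≤ δ ^ 2 → ‖G U V‖ ≤ Lf * ‖U‖
  rate_lt : 4 * (L * δ ^ 2 + Lf + γ + s * ((Lf + 2 * γ) * δ / η)) ^ 2 < ρ * γ * η ^ 2
  mult_lt : ((Lf + 2 * γ) * δ / η) ^ 2 / ρ < β - β₀

namespace BilinearProblem

variable {E H : Type*} [NormedAddCommGroup E] [InnerProductSpace ℝ E]
  [NormedAddCommGroup H] [InnerProductSpace ℝ H] (P : BilinearProblem E H)

/-- The constraint residual. -/
def res (U V : E) : H := P.B U V - P.b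

/-- The bound for the multipliers. -/
def M : ℝ := (P.Lf + 2 * P.γ) * P.δ / P.η

/-- The Lipschitz constant controlling the change of the multipliers. -/
def p : ℝ := P.L * P.δ ^ 2 + P.Lf + P.γ + P.s * P.M

/-- The penalized objective as a function of the second block, with a proximal term around `Z`. -/
def obj (U Z : E) (θ : H) (ω κ : ℝ) (V : E) : ℝ :=
  P.φ U V + P.γ / 2 * ‖U - V‖ ^ 2 + ω / 2 * ‖V - Z‖ ^ 2 + inner ℝ θ (P.res U V)
    + κ / 2 * ‖P.res U V‖ ^ 2

/-- The augmented Lagrangian. -/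
def lag (U V : E) (θ : H) : ℝ :=
  P.φ U V + P.γ / 2 * ‖U - V‖ ^ 2 + inner ℝ θ (P.res U V) + P.ρ / 2 * ‖P.res U V‖ ^ 2

/-- The penalty function at `(U, W)`, relaxed by the distance from `W` to `V`. -/
def comp (U V W : E) : ℝ := P.obj U V 0 P.γ (P.ρ / 2) W

lemma M_pos : 0 < P.M := by
  have := P.Lf_pos; have := P.γ_pos; have := P.δ_pos; have := P.η_pos
  unfold M; positivity

lemma p_pos : 0 < P.p := by
  have := P.Lf_pos; have := P.γ_pos; have := P.δ_pos; have := P.L_pos; have := P.s_nonneg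
  have := P.M_pos
  unfold p; positivity

lemma p_sq_lt : 4 * P.p ^ 2 < P.ρ * P.γ * P.η ^ 2 := P.rate_lt

lemma lag_eq_obj (U Z V : E) (θ : H) : P.lag U V θ = P.obj U Z θ 0 P.ρ V := by
  simp [lag, obj]

lemma res_symm (U V : E) : P.res U V = P.res V U := by simp [res, P.B_symm U V]

lemma lag_symm (U V : E) (θ : H) : P.lag U V θ = P.lag V U θ := by
  simp only [lag, P.res_symm U V, P.φ_symm U V, norm_sub_rev U V]

lemma comp_eq (U V W : E) : P.comp U V W = P.φ U W + P.γ / 2 * ‖U - W‖ ^ 2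
    + P.ρ / 4 * ‖P.res U W‖ ^ 2 + P.γ / 2 * ‖W - V‖ ^ 2 := by
  simp only [comp, obj, inner_zero_left]; ring

lemma res_cont : Continuous fun q : E × E => P.res q.1 q.2 := P.B_cont.sub continuous_const

lemma lag_cont : Continuous fun q : E × E × H => P.lag q.1 q.2.1 q.2.2 := by
  have h1 : Continuous fun q : E × E × H => P.φ q.1 q.2.1 :=
    P.φ_cont.comp (continuous_fst.prodMk (continuous_fst.comp continuous_snd))
  have h2 : Continuous fun q : E × E × H => P.res q.1 q.2.1 :=
    P.res_cont.comp (continuous_fst.prodMk (continuous_fst.comp continuous_snd))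
  unfold lag
  fun_prop

lemma comp_cont : Continuous fun q : E × E × E => P.comp q.1 q.2.1 q.2.2 := by
  have h1 : Continuous fun q : E × E × E => P.φ q.1 q.2.2 :=
    P.φ_cont.comp (continuous_fst.prodMk (continuous_snd.comp continuous_snd))
  have h2 : Continuous fun q : E × E × E => P.res q.1 q.2.2 :=
    P.res_cont.comp (continuous_fst.prodMk (continuous_snd.comp continuous_snd))
  simp only [comp_eq]
  fun_prop

lemma norm_sq_comb {F : Type*} [NormedAddCommGroup F] [InnerProductSpace ℝ F] (x y : F) {a b : ℝ}
    (hab : a + b = 1) :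
    ‖a • x + b • y‖ ^ 2 = a * ‖x‖ ^ 2 + b * ‖y‖ ^ 2 - a * b * ‖x - y‖ ^ 2 := by
  rw [norm_add_sq_real, norm_sub_sq_real, norm_smul, norm_smul, inner_smul_left, inner_smul_right,
    mul_pow, mul_pow, Real.norm_eq_abs, Real.norm_eq_abs, sq_abs, sq_abs]
  obtain rfl : b = 1 - a := by linarith
  simp; ring

lemma res_comb (U x y : E) {a b : ℝ} (hab : a + b = 1) :
    P.res U (a • x + b • y) = a • P.res U x + b • P.res U y := by
  obtain rfl : b = 1 - a := by linarith
  simp only [res, map_add, map_smul]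
  module

lemma res_sub (U x y : E) : P.res U x - P.res U y = P.B U (x - y) := by
  simp [res]

lemma obj_comb (U Z : E) (θ : H) (ω κ : ℝ) (x y : E) {a b : ℝ} (ha : 0 ≤ a) (hb : 0 ≤ b)
    (hab : a + b = 1) :
    P.obj U Z θ ω κ (a • x + b • y) ≤ a * P.obj U Z θ ω κ x + b * P.obj U Z θ ω κ y
      - a * b * ((P.γ + ω) / 2 * ‖x - y‖ ^ 2 + κ / 2 * ‖P.res U x - P.res U y‖ ^ 2) := by
  have h1 := (P.φ_convex U).2 (Set.mem_univ x) (Set.mem_univ y) ha hb hab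
  simp only [smul_eq_mul] at h1
  have e1 : U - (a • x + b • y) = a • (U - x) + b • (U - y) := by
    obtain rfl : b = 1 - a := by linarith
    module
  have e2 : a • x + b • y - Z = a • (x - Z) + b • (y - Z) := by
    obtain rfl : b = 1 - a := by linarith
    module
  have n1 := norm_sq_comb (U - x) (U - y) hab
  have n2 := norm_sq_comb (x - Z) (y - Z) hab
  have n3 := norm_sq_comb (P.res U x) (P.res U y) hab
  have s1 : (U - x) - (U - y) = y - x := by abel
  have s2 : (x - Z) - (y - Z) = x - y := by abel
  rw [s1, norm_sub_rev y x] at n1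
  rw [s2] at n2
  unfold obj
  rw [e1, e2, P.res_comb U x y hab, n1, n2, n3, inner_add_right, inner_smul_right,
    inner_smul_right]
  linarith

lemma obj_min {U Z : E} {θ : H} {ω κ : ℝ} {x : E}
    (hx : ∀ y, P.obj U Z θ ω κ x ≤ P.obj U Z θ ω κ y) (y : E) :
    P.obj U Z θ ω κ x + ((P.γ + ω) / 2 * ‖x - y‖ ^ 2 + κ / 2 * ‖P.res U x - P.res U y‖ ^ 2)
      ≤ P.obj U Z θ ω κ y := by
  set N := (P.γ + ω) / 2 * ‖x - y‖ ^ 2 + κ / 2 * ‖P.res U x - P.res U y‖ ^ 2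
  have key : ∀ t ∈ Set.Ioo (0 : ℝ) 1, P.obj U Z θ ω κ x + (1 - t) * N ≤ P.obj U Z θ ω κ y := by
    intro t ht
    have h1 := P.obj_comb U Z θ ω κ x y (a := 1 - t) (b := t) (by linarith [ht.2]) ht.1.le (by ring)
    have h2 := hx ((1 - t) • x + t • y)
    have h3 : t * (P.obj U Z θ ω κ x + (1 - t) * N) ≤ t * P.obj U Z θ ω κ y := by
      change _ ≤ _ - (1 - t) * t * N at h1
      linarith
    exact le_of_mul_le_mul_left h3 ht.1
  have hc : Filter.Tendsto (fun t : ℝ => P.obj U Z θ ω κ x + (1 - t) * N) (nhdsWithin 0 (Set.Ioi 0))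
      (nhds (P.obj U Z θ ω κ x + (1 - 0) * N)) := by
    apply Filter.Tendsto.mono_left _ nhdsWithin_le_nhds
    exact (Continuous.tendsto (by fun_prop) 0)
  have := le_of_tendsto hc
    (Filter.eventually_of_mem (Ioo_mem_nhdsGT (zero_lt_one)) fun t ht => key t ht)
  simpa using this

lemma obj_segment {U Z : E} {θ : H} {ω κ : ℝ} (hω : 0 ≤ ω) (hκ : 0 ≤ κ) {x y : E}
    (hy : ∀ z, P.obj U Z θ ω κ y ≤ P.obj U Z θ ω κ z) {t : ℝ} (h0 : 0 ≤ t) (h1 : t ≤ 1) :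
    P.obj U Z θ ω κ (x + t • (y - x)) + ((P.γ + ω) / 2 * ‖t • (y - x)‖ ^ 2
      + κ / 2 * ‖P.res U (x + t • (y - x)) - P.res U x‖ ^ 2) ≤ P.obj U Z θ ω κ x := by
  have e : x + t • (y - x) = (1 - t) • x + t • y := by module
  have hr : P.res U (x + t • (y - x)) - P.res U x = t • (P.res U y - P.res U x) := by
    rw [res_sub, res_sub]; simp
  rw [hr, e]
  have c := P.obj_comb U Z θ ω κ x y (a := 1 - t) (b := t) (by linarith) h0 (by ring)
  have m := P.obj_min hy x
  rw [norm_sub_rev x y, norm_sub_rev (P.res U x)] at c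
  rw [norm_smul, norm_smul, mul_pow, mul_pow, Real.norm_eq_abs, sq_abs]
  set N := (P.γ + ω) / 2 * ‖y - x‖ ^ 2 + κ / 2 * ‖P.res U y - P.res U x‖ ^ 2 with hN
  have hNn : 0 ≤ N := by have := P.γ_pos; positivity
  have e2 : (P.γ + ω) / 2 * (t ^ 2 * ‖y - x‖ ^ 2)
      + κ / 2 * (t ^ 2 * ‖P.res U y - P.res U x‖ ^ 2) = t ^ 2 * N := by rw [hN]; ring
  rw [e2]
  nlinarith [mul_nonneg (mul_nonneg h0 (sub_nonneg.2 h1)) hNn]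

lemma obj_stationary {U Z : E} {θ : H} {ω κ : ℝ} {V : E}
    (hV : ∀ W, P.obj U Z θ ω κ V ≤ P.obj U Z θ ω κ W) :
    P.G U V + P.γ • (V - U) + ω • (V - Z) + P.T (θ + κ • P.res U V) U = 0 := by
  refine ext_inner_right ℝ fun D => ?_
  set c1 := inner ℝ (P.γ • (V - U) + ω • (V - Z) + P.T (θ + κ • P.res U V) U) D with hc1
  set c2 := P.γ / 2 * ‖D‖ ^ 2 + ω / 2 * ‖D‖ ^ 2 + κ / 2 * ‖P.B U D‖ ^ 2
  have hexp : ∀ t : ℝ, P.obj U Z θ ω κ (V + t • D)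
      = P.φ U (V + t • D) + (P.obj U Z θ ω κ V - P.φ U V) + c1 * t + c2 * t ^ 2 := by
    intro t
    have e1 : U - (V + t • D) = -((V - U) + t • D) := by abel
    have e2 : V + t • D - Z = (V - Z) + t • D := by abel
    have e3 : P.res U (V + t • D) = P.res U V + t • P.B U D := by
      simp [res]; abel
    have e4 : U - V = -(V - U) := by abel
    unfold obj
    rw [e1, e2, e3, e4, norm_neg, norm_neg, norm_add_sq_real, norm_add_sq_real, norm_add_sq_real,
      hc1, inner_add_left, inner_add_left, P.T_adj, inner_add_left, inner_add_right]
    simp only [inner_smul_left, inner_smul_right, norm_smul, mul_pow, Real.norm_eq_abs, sq_abs,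
      c2]
    simp
    ring
  have hd : HasDerivAt (fun t : ℝ => P.obj U Z θ ω κ (V + t • D)) (inner ℝ (P.G U V) D + c1) 0 := by
    have h := ((P.φ_deriv U V D).add_const (P.obj U Z θ ω κ V - P.φ U V)).add
      (((hasDerivAt_id (0 : ℝ)).const_mul c1).add ((hasDerivAt_pow 2 (0 : ℝ)).const_mul c2))
    refine (h.congr_deriv (by simp)).congr_of_eventuallyEq (Filter.Eventually.of_forall fun t => ?_)
    simp only [hexp t, Pi.add_apply, id]
    ring
  have hmin : IsLocalMin (fun t : ℝ => P.obj U Z θ ω κ (V + t • D)) 0 :=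
    Filter.Eventually.of_forall fun t => by simpa using hV (V + t • D)
  have := hmin.hasDerivAt_eq_zero hd
  rw [inner_zero_left, ← this, hc1, ← inner_add_left]
  simp only [add_assoc]

/-- The penalty function defining the level sets. -/
def pen (U V : E) : ℝ :=
  P.φ U V + P.ρ₀ / 2 * ‖U - V‖ ^ 2 + P.ρ₀ / 2 * ‖P.B U V - P.b‖ ^ 2

lemma pen_le_comp (U V W : E) : P.pen U W + P.ρ₀ / 2 * ‖W - V‖ ^ 2 ≤ P.comp U V W := by
  have h1 := P.ρ₀_lt
  have h2 := P.ρ_big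
  rw [comp_eq, pen, res]
  nlinarith [sq_nonneg ‖U - W‖, sq_nonneg ‖P.B U W - P.b‖, sq_nonneg ‖W - V‖]

lemma pen_le_lag (U V : E) (θ : H) : P.pen U V ≤ P.lag U V θ + 1 / P.ρ * ‖θ‖ ^ 2 := by
  have h1 := P.ρ₀_lt
  have h2 := P.ρ_big
  have hρ := P.ρ_pos
  have h3 : 0 ≤ 1 / P.ρ * ‖θ + (P.ρ / 2) • P.res U V‖ ^ 2 := by positivity
  rw [norm_add_sq_real, inner_smul_right, norm_smul, mul_pow, Real.norm_eq_abs, sq_abs] at h3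
  have h4 : 1 / P.ρ * (‖θ‖ ^ 2 + 2 * (P.ρ / 2 * inner ℝ θ (P.res U V))
      + (P.ρ / 2) ^ 2 * ‖P.res U V‖ ^ 2)
      = 1 / P.ρ * ‖θ‖ ^ 2 + inner ℝ θ (P.res U V) + P.ρ / 4 * ‖P.res U V‖ ^ 2 := by
    field_simp; ring
  rw [h4] at h3
  change P.φ U V + P.ρ₀ / 2 * ‖U - V‖ ^ 2 + P.ρ₀ / 2 * ‖P.res U V‖ ^ 2 ≤ _
  rw [lag]
  nlinarith [sq_nonneg ‖U - V‖, sq_nonneg ‖P.res U V‖]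

/-- Points at which the a priori bounds of the level set are available. -/
structure Good (U V : E) : Prop where
  norm_le : ‖U‖ ≤ P.δ
  add_le : ‖U‖ + ‖V‖ ≤ 2 * P.δ
  sing : ∀ μ, P.η * ‖μ‖ ≤ ‖P.T μ U‖

variable {P}

lemma Good.mul_le {U V : E} (h : P.Good U V) : ‖U‖ * ‖V‖ ≤ P.δ ^ 2 := by
  have := h.add_le
  have := P.δ_pos
  nlinarith [sq_nonneg (‖U‖ - ‖V‖), norm_nonneg U, norm_nonneg V]

variable (P)

lemma norm_mul_scale [Nontrivial H] {U W : E} {N τ : ℝ} (hU : 0 < ‖U‖) (hN : 0 < N)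
    (h : P.pen U W + P.ρ₀ / 2 * τ ^ 2 ≤ P.β)
    (hle : N ^ 2 + (‖U‖ * ‖W‖ / N) ^ 2 ≤ ‖U‖ ^ 2 + ‖W‖ ^ 2 + τ ^ 2) : N ≤ P.δ := by
  have hρ := P.ρ₀_pos
  set c := N / ‖U‖
  have hc : 0 < c := by positivity
  have e1 : ‖c • U‖ = N := by
    rw [norm_smul, Real.norm_eq_abs, abs_of_pos hc]
    exact div_mul_cancel₀ _ hU.ne'
  have e2 : ‖c⁻¹ • W‖ = ‖U‖ * ‖W‖ / N := by
    rw [norm_smul, Real.norm_eq_abs, abs_of_pos (inv_pos.2 hc), inv_div]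
    ring
  have e3 : P.B (c • U) (c⁻¹ • W) = P.B U W := by
    simp [smul_smul, hc.ne']
  have e4 : inner ℝ (c • U) (c⁻¹ • W) = inner ℝ U W := by
    rw [inner_smul_left, inner_smul_right]
    simp only [conj_trivial]
    field_simp
  have := (P.level_norm (c • U) (c⁻¹ • W) ?_).1
  · rwa [e1] at this
  · rw [P.φ_scale _ _ _ hc.ne', e3, norm_sub_sq_real, e1, e2, e4]
    rw [pen, norm_sub_sq_real] at h
    nlinarith

lemma good_of_comp_le [Nontrivial H] {U V W : E} (h : P.comp U V W ≤ P.β) :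
    P.Good U V ∧ P.Good U W := by
  have hρ := P.ρ₀_pos
  have hη := P.η_pos
  have h1 := (P.pen_le_comp U V W).trans h
  have h2 : P.pen U W ≤ P.β := by nlinarith [sq_nonneg ‖W - V‖]
  have hs := P.level_sing U W h2
  obtain ⟨hU, hW⟩ := P.level_norm U W h2
  have hU0 : 0 < ‖U‖ := by
    rw [norm_pos_iff]
    rintro rfl
    obtain ⟨μ, hμ⟩ := exists_ne (0 : H)
    have := hs μ
    simp only [map_zero, norm_zero] at this
    nlinarith [norm_pos_iff.2 hμ]
  set τ := ‖W - V‖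
  have hτ : 0 ≤ τ := norm_nonneg _
  have hV : ‖V‖ ≤ ‖W‖ + τ := by
    have := norm_sub_norm_le V W
    rw [norm_sub_rev] at this
    linarith
  have hq := norm_nonneg W
  set x := ‖U‖
  set q := ‖W‖
  have hN : 0 < (x + q + τ) / 2 := by positivity
  have hle : ((x + q + τ) / 2) ^ 2 + (x * q / ((x + q + τ) / 2)) ^ 2 ≤ x ^ 2 + q ^ 2 + τ ^ 2 := by
    rw [div_pow (x * q), ← le_sub_iff_add_le', div_le_iff₀ (by positivity)]
    have k1 : 0 ≤ x * q * (x - q) ^ 2 := by positivity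
    have k2 : 0 ≤ τ ^ 3 * (4 * (x + q) + 3 * τ) := by positivity
    have k3 : 0 ≤ (x - q) ^ 2 * ((x + q + τ) ^ 2 + 4 * x * q) := by positivity
    have k4 : 0 ≤ (x - q) ^ 2 * (x + q) ^ 2 := by positivity
    nlinarith
  have := P.norm_mul_scale hU0 hN h1 hle
  exact ⟨⟨hU, by linarith, hs⟩, ⟨hU, by linarith, hs⟩⟩

lemma le_p [Nontrivial H] {U V : E} (h : P.Good U V) : P.L * P.δ ^ 2 + 2 * P.γ ≤ P.p := by
  have hη := P.η_pos
  have hδ := P.δ_pos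
  have h0 := P.Lf_pos
  have h1 := P.γ_pos
  obtain ⟨μ, hμ⟩ := exists_ne (0 : H)
  have hμ' := norm_pos_iff.2 hμ
  have h2 : P.η ≤ P.s * P.δ := by
    have k := (h.sing μ).trans (P.T_le μ U)
    have k2 : P.s * ‖μ‖ * ‖U‖ ≤ P.s * ‖μ‖ * P.δ :=
      mul_le_mul_of_nonneg_left h.norm_le (mul_nonneg P.s_nonneg hμ'.le)
    refine le_of_mul_le_mul_right ?_ hμ'
    linarith
  have h3 : P.Lf + 2 * P.γ ≤ P.s * P.M := by
    rw [M, ← mul_div_assoc, le_div_iff₀ hη]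
    nlinarith
  unfold p
  linarith

lemma mult_le {U V : E} {lam : H} (h : P.Good U V)
    (hs : P.G U V + P.γ • (V - U) + P.T lam U = 0) : ‖lam‖ ≤ P.M := by
  have hγ := P.γ_pos
  have hL := P.Lf_pos
  have h1 : P.T lam U = -(P.G U V + P.γ • (V - U)) := by
    rw [eq_neg_iff_add_eq_zero, ← hs]; abel
  rw [M, le_div_iff₀ P.η_pos, mul_comm]
  refine (h.sing lam).trans ?_
  rw [h1, norm_neg]
  refine (norm_add_le _ _).trans ?_
  rw [norm_smul, Real.norm_eq_abs, abs_of_pos hγ]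
  have h2 := P.G_le U V h.mul_le
  have h3 := norm_sub_le V U
  have h4 := h.norm_le
  have h5 := h.add_le
  nlinarith

lemma mult_error [Nontrivial H] {U₁ V₁ U V : E} {lam y : H} {ω : ℝ} (hω0 : 0 ≤ ω)
    (hωγ : ω ≤ P.γ) (h1 : P.Good U₁ V₁) (hUV₁ : P.Good U V₁) (hUV : P.Good U V)
    (s1 : P.G U₁ V₁ + P.γ • (V₁ - U₁) + P.T lam U₁ = 0)
    (s2 : P.G U V + P.γ • (V - U) + ω • (V - V₁) + P.T y U = 0) :
    P.η * ‖y - lam‖ ≤ P.p * (‖U - U₁‖ + ‖V - V₁‖) := by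
  have hγ := P.γ_pos
  have hL := P.L_pos
  have hδ := P.δ_pos
  have hp := P.le_p hUV
  have hM := P.mult_le h1 s1
  have e : P.T (y - lam) U = (-(P.G U V - P.G U₁ V₁) + -((P.γ + ω) • (V - V₁)))
      + (P.γ • (U - U₁) - P.T lam (U - U₁)) := by
    have : P.T (y - lam) U = P.T y U - P.T lam U := by simp
    rw [this, map_sub, ← sub_eq_zero]
    rw [← sub_eq_zero_of_eq (s2.trans s1.symm)]
    module
  have n1 : ‖-(P.G U V - P.G U₁ V₁)‖
      ≤ P.L * P.δ ^ 2 * ‖V - V₁‖ + (P.L * P.δ ^ 2 + P.Lf) * ‖U - U₁‖ := by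
    rw [norm_neg]
    refine (P.G_lip U₁ V₁ U V h1.mul_le hUV.mul_le).trans ?_
    have k1 : ‖U‖ * ‖U‖ ≤ P.δ ^ 2 := by
      rw [sq]; exact mul_self_le_mul_self (norm_nonneg _) hUV.norm_le
    have k2 := mul_le_mul_of_nonneg_right k1 (mul_nonneg hL.le (norm_nonneg (V - V₁)))
    have k3 := mul_le_mul_of_nonneg_right hUV₁.mul_le (mul_nonneg hL.le (norm_nonneg (U - U₁)))
    linarith
  have n2 : ‖-((P.γ + ω) • (V - V₁))‖ ≤ 2 * P.γ * ‖V - V₁‖ := by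
    rw [norm_neg, norm_smul, Real.norm_eq_abs, abs_of_pos (by linarith)]
    exact mul_le_mul_of_nonneg_right (by linarith) (norm_nonneg _)
  have n3 : ‖P.γ • (U - U₁)‖ = P.γ * ‖U - U₁‖ := by
    rw [norm_smul, Real.norm_eq_abs, abs_of_pos hγ]
  have n4 : ‖P.T lam (U - U₁)‖ ≤ P.s * P.M * ‖U - U₁‖ := by
    refine (P.T_le _ _).trans ?_
    have := mul_le_mul_of_nonneg_left hM P.s_nonneg
    exact mul_le_mul_of_nonneg_right this (norm_nonneg _)
  refine (hUV.sing _).trans ?_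
  rw [e]
  refine (norm_add_le _ _).trans ?_
  have m1 := norm_add_le (-(P.G U V - P.G U₁ V₁)) (-((P.γ + ω) • (V - V₁)))
  have m2 := norm_sub_le (P.γ • (U - U₁)) (P.T lam (U - U₁))
  have m3 := mul_le_mul_of_nonneg_right hp (norm_nonneg (V - V₁))
  have m4 : P.p = P.L * P.δ ^ 2 + P.Lf + P.γ + P.s * P.M := rfl
  rw [mul_add]
  nth_rewrite 1 [m4]
  linarith

lemma mult_error_sq {u v e : ℝ} (he : 0 ≤ e)
    (h : P.η * e ≤ P.p * (u + v)) : 4 * e ^ 2 ≤ P.ρ * P.γ * (u + v) ^ 2 := by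
  have hη := P.η_pos
  have hp := P.p_sq_lt
  have h1 : (P.η * e) ^ 2 ≤ (P.p * (u + v)) ^ 2 := pow_le_pow_left₀ (by positivity) h 2
  have h2 : 0 ≤ (P.ρ * P.γ * P.η ^ 2 - 4 * P.p ^ 2) * (u + v) ^ 2 :=
    mul_nonneg (by linarith) (sq_nonneg _)
  refine le_of_mul_le_mul_left ?_ (sq_pos_of_pos hη)
  nlinarith

lemma exists_comp_min (U V : E) : ∃ W, ∀ W', P.comp U V W ≤ P.comp U V W' := by
  have hρ := P.ρ₀_pos
  set K := Prod.snd '' {q : E × E | P.pen q.1 q.2 ≤ P.comp U V V}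
  have hK : IsCompact K := (P.level_compact _).image continuous_snd
  have hmem : ∀ W, P.comp U V W ≤ P.comp U V V → W ∈ K := fun W hW =>
    ⟨(U, W), by
      have := P.pen_le_comp U V W
      change P.pen U W ≤ _
      nlinarith [sq_nonneg ‖W - V‖], rfl⟩
  obtain ⟨W, hW, hmin⟩ := hK.exists_isMinOn ⟨V, hmem V le_rfl⟩
    (f := P.comp U V)
    (P.comp_cont.comp (by fun_prop : Continuous fun W : E => (U, V, W))).continuousOn
  refine ⟨W, fun W' => ?_⟩
  by_cases h : W' ∈ K
  · exact hmin h
  · have h1 : P.comp U V V < P.comp U V W' := by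
      by_contra hc
      exact h (hmem W' (not_lt.1 hc))
    exact (hmin (hmem V le_rfl) : _).trans h1.le

lemma exists_lag_min (U : E) (θ : H) : ∃ W, ∀ W', P.lag U W θ ≤ P.lag U W' θ := by
  set K := Prod.snd '' {q : E × E | P.pen q.1 q.2 ≤ P.lag U U θ + 1 / P.ρ * ‖θ‖ ^ 2}
  have hK : IsCompact K := (P.level_compact _).image continuous_snd
  have hmem : ∀ W, P.lag U W θ ≤ P.lag U U θ → W ∈ K := fun W hW =>
    ⟨(U, W), by
      have := P.pen_le_lag U W θ
      change P.pen U W ≤ _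
      linarith, rfl⟩
  obtain ⟨W, hW, hmin⟩ := hK.exists_isMinOn ⟨U, hmem U le_rfl⟩
    (f := fun W => P.lag U W θ)
    (P.lag_cont.comp (by fun_prop : Continuous fun W : E => (U, W, θ))).continuousOn
  refine ⟨W, fun W' => ?_⟩
  by_cases h : W' ∈ K
  · exact hmin h
  · have h1 : P.lag U U θ < P.lag U W' θ := by
      by_contra hc
      exact h (hmem W' (not_lt.1 hc))
    exact (hmin (hmem U le_rfl) : _).trans h1.le

lemma stationary_V {U V : E} {θ θ' : H} (hV : ∀ W, P.lag U V θ ≤ P.lag U W θ)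
    (hθ : θ' = θ + P.ρ • P.res U V) :
    P.G U V + P.γ • (V - U) + P.T θ' U = 0 := by
  have := P.obj_stationary (U := U) (Z := 0) (θ := θ) (ω := 0) (κ := P.ρ) (V := V)
    (by simpa only [lag_eq_obj P U 0] using hV)
  rw [← hθ] at this
  simpa using this

lemma comp_stationary {U V W : E} (hW : ∀ W', P.comp U V W ≤ P.comp U V W') :
    P.G U W + P.γ • (W - U) + P.γ • (W - V) + P.T ((P.ρ / 2) • P.res U W) U = 0 := by
  have := P.obj_stationary hW
  simpa using this

lemma comp_min_le {U V W : E} (hW : ∀ W', P.comp U V W ≤ P.comp U V W') :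
    P.comp U V W ≤ P.φ U V + P.γ / 2 * ‖U - V‖ ^ 2
      + P.ρ / 2 * inner ℝ (P.res U V) (P.res U W) - P.ρ / 4 * ‖P.res U W‖ ^ 2
      - P.γ * ‖W - V‖ ^ 2 := by
  have h := P.obj_min hW V
  have e : P.comp U V V = P.φ U V + P.γ / 2 * ‖U - V‖ ^ 2 + P.ρ / 4 * ‖P.res U V‖ ^ 2 := by
    rw [comp_eq]; simp
  change P.comp U V W + _ ≤ P.comp U V V at h
  rw [e, norm_sub_sq_real (P.res U W), real_inner_comm] at h
  linarith

lemma comp_min_le_lag [Nontrivial H] {U₁ V₁ U W : E} {lam : H} (h1 : P.Good U₁ V₁)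
    (s1 : P.G U₁ V₁ + P.γ • (V₁ - U₁) + P.T lam U₁ = 0)
    (hW : ∀ W', P.comp U V₁ W ≤ P.comp U V₁ W') (hβ : P.comp U V₁ W ≤ P.β)
    (hF : P.lag U V₁ lam + P.γ / 2 * ‖U - U₁‖ ^ 2 ≤ P.lag U₁ V₁ lam) :
    P.comp U V₁ W ≤ P.lag U₁ V₁ lam := by
  have hρ := P.ρ_pos
  have hγ := P.γ_pos
  obtain ⟨g1, g2⟩ := P.good_of_comp_le hβ
  have he := P.mult_error_sq (norm_nonneg _)
    (P.mult_error hγ.le le_rfl h1 g1 g2 s1 (P.comp_stationary hW))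
  have hc := P.comp_min_le hW
  set e := (P.ρ / 2) • P.res U W - lam with hedef
  have hi : inner ℝ e (P.res U V₁) = P.ρ / 2 * inner ℝ (P.res U V₁) (P.res U W)
      - inner ℝ lam (P.res U V₁) := by
    rw [hedef, inner_sub_left, inner_smul_left, real_inner_comm]; simp
  have hn : 0 ≤ ‖e - P.ρ • P.res U V₁‖ ^ 2 := sq_nonneg _
  rw [norm_sub_sq_real, inner_smul_right, norm_smul, mul_pow, Real.norm_eq_abs, sq_abs, hi] at hn
  rw [lag] at hF
  have k1 : 0 ≤ P.ρ / 4 * ‖P.res U W‖ ^ 2 := by positivity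
  have k2 : P.ρ * (P.comp U V₁ W - P.lag U₁ V₁ lam) ≤ 0 := by
    have k3 : P.ρ * (P.comp U V₁ W - P.lag U₁ V₁ lam) ≤ P.ρ * (P.ρ / 2 *
        inner ℝ (P.res U V₁) (P.res U W) - inner ℝ lam (P.res U V₁)
        - P.γ * ‖W - V₁‖ ^ 2 - P.γ / 2 * ‖U - U₁‖ ^ 2 - P.ρ / 2 * ‖P.res U V₁‖ ^ 2) :=
      mul_le_mul_of_nonneg_left (by linarith) hρ.le
    have k4 : 0 ≤ P.ρ * P.γ * ((‖U - U₁‖ - ‖W - V₁‖) ^ 2 + ‖W - V₁‖ ^ 2 + ‖U - U₁‖ ^ 2) := by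
      positivity
    nlinarith
  nlinarith

lemma isClosed_comp_le (V : E) : IsClosed {U | ∃ W, P.comp U V W ≤ P.β} := by
  have hρ := P.ρ₀_pos
  have : {U | ∃ W, P.comp U V W ≤ P.β}
      = Prod.fst '' ({q : E × E | P.pen q.1 q.2 ≤ P.β} ∩ {q | P.comp q.1 V q.2 ≤ P.β}) := by
    ext U
    constructor
    · rintro ⟨W, hW⟩
      refine ⟨(U, W), ⟨?_, hW⟩, rfl⟩
      have := P.pen_le_comp U V W
      change P.pen U W ≤ _
      nlinarith [sq_nonneg ‖W - V‖]
    · rintro ⟨q, ⟨-, hq⟩, rfl⟩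
      exact ⟨q.2, hq⟩
  rw [this]
  refine IsCompact.isClosed (((P.level_compact _).inter_right ?_).image continuous_fst)
  exact isClosed_le (P.comp_cont.comp (by fun_prop : Continuous fun q : E × E => (q.1, V, q.2)))
    continuous_const

lemma exists_comp_le_of_min [Nontrivial H] {U₁ V₁ U₂ : E} {lam : H}
    (s1 : P.G U₁ V₁ + P.γ • (V₁ - U₁) + P.T lam U₁ = 0)
    (inv : ∃ W, P.comp U₁ V₁ W ≤ P.β) (hL : P.lag U₁ V₁ lam < P.β)
    (hU : ∀ U, P.lag U₂ V₁ lam ≤ P.lag U V₁ lam) : ∃ W, P.comp U₂ V₁ W ≤ P.β := by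
  have hρ := P.ρ_pos
  have h1 : P.Good U₁ V₁ := (P.good_of_comp_le inv.choose_spec).1
  have hseg : ∀ t : ℝ, 0 ≤ t → t ≤ 1 → P.lag (U₁ + t • (U₂ - U₁)) V₁ lam
      + P.γ / 2 * ‖U₁ + t • (U₂ - U₁) - U₁‖ ^ 2 ≤ P.lag U₁ V₁ lam := by
    intro t h0 h1
    have := P.obj_segment (U := V₁) (Z := 0) (θ := lam) (ω := 0) (κ := P.ρ) (x := U₁) (y := U₂)
      le_rfl hρ.le (by
        intro z
        have := hU z
        rwa [P.lag_symm U₂, P.lag_symm z, P.lag_eq_obj V₁ 0, P.lag_eq_obj V₁ 0] at this) h0 h1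
    rw [P.lag_symm, P.lag_symm U₁, P.lag_eq_obj V₁ 0, P.lag_eq_obj V₁ 0, add_sub_cancel_left]
    have k : 0 ≤ P.ρ / 2 * ‖P.res V₁ (U₁ + t • (U₂ - U₁)) - P.res V₁ U₁‖ ^ 2 := by positivity
    rw [add_zero] at this
    linarith
  set S : Set ℝ := {t | ∃ W, P.comp (U₁ + t • (U₂ - U₁)) V₁ W ≤ P.β}
  have hS : IsClosed S := (P.isClosed_comp_le V₁).preimage
    (by fun_prop : Continuous fun t : ℝ => U₁ + t • (U₂ - U₁))
  have hsub : Set.Icc (0 : ℝ) 1 ⊆ S := by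
    refine IsClosed.Icc_subset_of_forall_exists_gt (hS.inter isClosed_Icc) ?_ ?_
    · simpa [S] using inv
    · rintro t ⟨⟨W₀, hW₀⟩, ht0, ht1⟩ y hy
      obtain ⟨W, hW⟩ := P.exists_comp_min (U₁ + t • (U₂ - U₁)) V₁
      have hlt := (P.comp_min_le_lag h1 s1 hW ((hW W₀).trans hW₀)
        (hseg t ht0 ht1.le)).trans_lt hL
      have hc : Continuous fun t : ℝ => P.comp (U₁ + t • (U₂ - U₁)) V₁ W :=
        P.comp_cont.comp (by fun_prop : Continuous fun t : ℝ => (U₁ + t • (U₂ - U₁), V₁, W))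
      have hev : ∀ᶠ τ in nhdsWithin t (Set.Ioi t),
          P.comp (U₁ + τ • (U₂ - U₁)) V₁ W < P.β :=
        (hc.continuousAt.eventually_lt continuousAt_const hlt).filter_mono nhdsWithin_le_nhds
      obtain ⟨τ, h1, h2⟩ := (hev.and (Ioc_mem_nhdsGT hy)).exists
      exact ⟨τ, ⟨W, h1.le⟩, h2⟩
  simpa [S] using hsub (Set.right_mem_Icc.2 zero_le_one)

lemma quad_form_nonpos (a c y e : H) {g h v : ℝ} (he : 4 * ‖e‖ ^ 2 ≤ (g + h) ^ 2) :
    1 / 3 * (-(1 / 2) * g ^ 2 - 1 / 2 * v ^ 2 - inner ℝ y a + inner ℝ e a - 1 / 4 * ‖a‖ ^ 2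
        - 1 / 2 * ‖a - c‖ ^ 2)
      + 2 / 3 * (inner ℝ e c - 1 / 2 * ‖c‖ ^ 2 - 1 / 2 * g ^ 2 - 3 / 2 * h ^ 2 - ‖y‖ ^ 2)
      + 1 / 9 * (v + h) ^ 2 ≤ 0 := by
  have k1 : 0 ≤ ‖(4 : ℝ) • y + a‖ ^ 2 := sq_nonneg _
  have k2 : 0 ≤ ‖(48 : ℝ) • e - (7 : ℝ) • (a + (2 : ℝ) • c)‖ ^ 2 := sq_nonneg _
  have k3 : 0 ≤ ‖a - (1.2 : ℝ) • c‖ ^ 2 := sq_nonneg _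
  simp only [norm_add_sq_real, norm_sub_sq_real, norm_smul, inner_smul_left, inner_smul_right,
    inner_add_right, mul_pow, Real.norm_eq_abs, sq_abs, conj_trivial] at k1 k2 k3
  rw [norm_sub_sq_real]
  nlinarith [sq_nonneg (3 * g - 4 * h), sq_nonneg (v - 2 * h), sq_nonneg ‖a‖, sq_nonneg ‖c‖]

lemma exists_comp_le_next [Nontrivial H] {U₁ V₁ U₂ V₂ : E} {lam : H} {Bl : ℝ}
    (h1 : P.Good U₁ V₁) (s1 : P.G U₁ V₁ + P.γ • (V₁ - U₁) + P.T lam U₁ = 0)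
    (inv : ∃ W, P.comp U₂ V₁ W ≤ P.β)
    (hBl : P.lag U₂ V₁ lam + P.γ / 2 * ‖U₂ - U₁‖ ^ 2 ≤ Bl)
    (hV : ∀ V, P.lag U₂ V₂ lam ≤ P.lag U₂ V lam) : ∃ W, P.comp U₂ V₂ W ≤ Bl := by
  have hρ := P.ρ_pos
  have hγ := P.γ_pos
  obtain ⟨W₀, hW₀⟩ := inv
  obtain ⟨W, hW⟩ := P.exists_comp_min U₂ V₁
  obtain ⟨g1, g2⟩ := P.good_of_comp_le ((hW W₀).trans hW₀)
  have he := P.mult_error_sq (norm_nonneg _)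
    (P.mult_error hγ.le le_rfl h1 g1 g2 s1 (P.comp_stationary hW))
  have hc := P.comp_min_le hW
  refine ⟨(1 / 3 : ℝ) • V₂ + (2 / 3 : ℝ) • W, ?_⟩
  have hcomb := P.obj_comb U₂ V₂ 0 P.γ (P.ρ / 2) V₂ W (a := 1 / 3) (b := 2 / 3)
    (by norm_num) (by norm_num) (by norm_num)
  change P.comp U₂ V₂ _ ≤ 1 / 3 * P.comp U₂ V₂ V₂ + 2 / 3 * P.comp U₂ V₂ W - _ at hcomb
  have hmin := P.obj_min (U := U₂) (Z := 0) (θ := lam) (ω := 0) (κ := P.ρ) (x := V₂)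
    (by simpa only [lag_eq_obj P U₂ 0] using hV) V₁
  rw [← lag_eq_obj, ← lag_eq_obj, add_zero] at hmin
  rw [comp_eq] at hc
  rw [comp_eq P U₂ V₂ V₂, comp_eq P U₂ V₂ W, sub_self, norm_zero] at hcomb
  set sg := √(P.ρ * P.γ) with hsg
  have hsg2 : sg ^ 2 = P.ρ * P.γ := Real.sq_sqrt (by positivity)
  have hD : ‖V₂ - W‖ ^ 2 ≤ (‖V₂ - V₁‖ + ‖W - V₁‖) ^ 2 := by
    refine pow_le_pow_left₀ (norm_nonneg _) ?_ 2
    have := norm_sub_le (V₂ - V₁) (W - V₁)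
    rwa [sub_sub_sub_cancel_right] at this
  have hq := quad_form_nonpos (P.ρ • P.res U₂ V₂) (P.ρ • P.res U₂ V₁)
    ((P.ρ / 2) • P.res U₂ W) ((P.ρ / 2) • P.res U₂ W - lam) (g := sg * ‖U₂ - U₁‖)
    (h := sg * ‖W - V₁‖) (v := sg * ‖V₂ - V₁‖) (by
      rw [← mul_add, mul_pow, hsg2]; exact he)
  rw [← mul_add, mul_pow, mul_pow, mul_pow, mul_pow, hsg2, ← smul_sub] at hq
  simp only [inner_sub_left, norm_smul, inner_smul_left, inner_smul_right,
    mul_pow, Real.norm_eq_abs, sq_abs, conj_trivial] at hq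
  rw [norm_sub_rev W V₂] at hcomb
  rw [lag] at hmin
  have hBl' := hBl
  rw [lag] at hmin hBl
  rw [real_inner_comm] at hc
  set A := P.comp U₂ V₂ ((1 / 3 : ℝ) • V₂ + (2 / 3 : ℝ) • W)
  set i1 := inner ℝ (P.res U₂ W) (P.res U₂ V₁)
  set i2 := inner ℝ (P.res U₂ W) (P.res U₂ V₂)
  set i3 := inner ℝ lam (P.res U₂ V₁)
  set i4 := inner ℝ lam (P.res U₂ V₂)
  have hkap : 0 ≤ P.ρ / 2 / 2 * ‖P.res U₂ V₂ - P.res U₂ W‖ ^ 2 := by positivity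
  have key : A - Bl ≤ 1 / 3 * (-(P.γ / 2) * ‖U₂ - U₁‖ ^ 2 - P.γ / 2 * ‖V₂ - V₁‖ ^ 2 - i4
        - P.ρ / 4 * ‖P.res U₂ V₂‖ ^ 2 - P.ρ / 2 * ‖P.res U₂ V₂ - P.res U₂ V₁‖ ^ 2)
      + 2 / 3 * (-i3 - P.ρ / 2 * ‖P.res U₂ V₁‖ ^ 2 + P.ρ / 2 * i1 - P.ρ / 4 * ‖P.res U₂ W‖ ^ 2
        - 3 * P.γ / 2 * ‖W - V₁‖ ^ 2 - P.γ / 2 * ‖U₂ - U₁‖ ^ 2)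
      + 1 / 9 * P.γ * (‖V₂ - V₁‖ + ‖W - V₁‖) ^ 2 := by
    have hD' := mul_le_mul_of_nonneg_left hD hγ.le
    linarith
  have key2 := mul_le_mul_of_nonneg_left key hρ.le
  have : P.ρ * (A - Bl) ≤ 0 := by
    refine key2.trans (le_trans (le_of_eq ?_) hq)
    ring
  nlinarith

/-- The descent constant. -/
def ν : ℝ := P.γ / 2 - 2 * P.p ^ 2 / (P.η ^ 2 * P.ρ)

lemma ν_pos : 0 < P.ν := by
  have := P.η_pos
  have := P.ρ_pos
  have := P.p_sq_lt
  rw [ν, sub_pos, div_lt_iff₀ (by positivity)]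
  nlinarith

lemma lag_add_mult (U V : E) (θ : H) :
    P.lag U V (θ + P.ρ • P.res U V) = P.lag U V θ + P.ρ * ‖P.res U V‖ ^ 2 := by
  rw [lag, lag, inner_add_left, inner_smul_left, real_inner_self_eq_norm_sq]
  simp only [conj_trivial]; ring

/-- One iteration of the alternating direction method of multipliers. -/
structure Step (U₁ V₁ : E) (lam₁ : H) (U₂ V₂ : E) (lam₂ : H) : Prop where
  minU : ∀ U, P.lag U₂ V₁ lam₁ ≤ P.lag U V₁ lam₁
  minV : ∀ V, P.lag U₂ V₂ lam₁ ≤ P.lag U₂ V lam₁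
  upd : lam₂ = lam₁ + P.ρ • P.res U₂ V₂

variable {P}

lemma Step.lag_le_left {U₁ V₁ U₂ V₂ : E} {lam₁ lam₂ : H} (h : P.Step U₁ V₁ lam₁ U₂ V₂ lam₂)
    (U : E) : P.lag U₂ V₁ lam₁ + P.γ / 2 * ‖U₂ - U‖ ^ 2
      + P.ρ / 2 * ‖P.res U₂ V₁ - P.res U V₁‖ ^ 2 ≤ P.lag U V₁ lam₁ := by
  have hmin := P.obj_min (U := V₁) (Z := 0) (θ := lam₁) (ω := 0) (κ := P.ρ) (x := U₂)
    (by
      intro y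
      have := h.minU y
      rwa [P.lag_symm, P.lag_symm y, lag_eq_obj P V₁ 0, lag_eq_obj P V₁ 0] at this) U
  rw [← lag_eq_obj, ← lag_eq_obj, add_zero, P.lag_symm, P.lag_symm _ U, P.res_symm,
    P.res_symm _ U] at hmin
  linarith

lemma Step.lag_le_right {U₁ V₁ U₂ V₂ : E} {lam₁ lam₂ : H} (h : P.Step U₁ V₁ lam₁ U₂ V₂ lam₂)
    (V : E) : P.lag U₂ V₂ lam₁ + P.γ / 2 * ‖V₂ - V‖ ^ 2 ≤ P.lag U₂ V lam₁ := by
  have hρ := P.ρ_pos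
  have hmin := P.obj_min (U := U₂) (Z := 0) (θ := lam₁) (ω := 0) (κ := P.ρ) (x := V₂)
    (by simpa only [lag_eq_obj P U₂ 0] using h.minV) V
  rw [← lag_eq_obj, ← lag_eq_obj, add_zero] at hmin
  have : 0 ≤ P.ρ / 2 * ‖P.res U₂ V₂ - P.res U₂ V‖ ^ 2 := by positivity
  linarith

lemma Step.stationary {U₁ V₁ U₂ V₂ : E} {lam₁ lam₂ : H} (h : P.Step U₁ V₁ lam₁ U₂ V₂ lam₂) :
    P.G U₂ V₂ + P.γ • (V₂ - U₂) + P.T lam₂ U₂ = 0 :=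
  P.stationary_V h.minV h.upd

lemma Step.mult_change [Nontrivial H] {U₁ V₁ U₂ V₂ : E} {lam₁ lam₂ : H}
    (h : P.Step U₁ V₁ lam₁ U₂ V₂ lam₂) (g1 : P.Good U₁ V₁) (g21 : P.Good U₂ V₁)
    (g2 : P.Good U₂ V₂) (s1 : P.G U₁ V₁ + P.γ • (V₁ - U₁) + P.T lam₁ U₁ = 0) :
    P.η * ‖lam₂ - lam₁‖ ≤ P.p * (‖U₂ - U₁‖ + ‖V₂ - V₁‖) := by
  refine P.mult_error (ω := 0) le_rfl P.γ_pos.le g1 g21 g2 s1 ?_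
  simpa using h.stationary

lemma Step.descent [Nontrivial H] {U₁ V₁ U₂ V₂ : E} {lam₁ lam₂ : H}
    (h : P.Step U₁ V₁ lam₁ U₂ V₂ lam₂) (g1 : P.Good U₁ V₁) (g21 : P.Good U₂ V₁)
    (g2 : P.Good U₂ V₂) (s1 : P.G U₁ V₁ + P.γ • (V₁ - U₁) + P.T lam₁ U₁ = 0) {Bl : ℝ}
    (hBl : P.lag U₂ V₁ lam₁ + P.γ / 2 * ‖U₂ - U₁‖ ^ 2 ≤ Bl) :
    P.lag U₂ V₂ lam₂ ≤ Bl - P.ν * (‖U₂ - U₁‖ ^ 2 + ‖V₂ - V₁‖ ^ 2) := by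
  have hρ := P.ρ_pos
  have hη := P.η_pos
  have hch := h.mult_change g1 g21 g2 s1
  have e1 : lam₂ - lam₁ = P.ρ • P.res U₂ V₂ := by rw [h.upd]; abel
  rw [e1, norm_smul, Real.norm_eq_abs, abs_of_pos hρ] at hch
  have h2 := pow_le_pow_left₀ (by positivity) hch 2
  have hV := h.lag_le_right V₁
  have h3 : P.ρ * ‖P.res U₂ V₂‖ ^ 2
      ≤ 2 * P.p ^ 2 / (P.η ^ 2 * P.ρ) * (‖U₂ - U₁‖ ^ 2 + ‖V₂ - V₁‖ ^ 2) := by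
    rw [div_mul_eq_mul_div, le_div_iff₀ (by positivity)]
    have : 0 ≤ P.p ^ 2 * (‖U₂ - U₁‖ - ‖V₂ - V₁‖) ^ 2 := by positivity
    linarith
  rw [h.upd, lag_add_mult, ν]
  linarith

lemma Step.next [Nontrivial H] {U₁ V₁ U₂ V₂ : E} {lam₁ lam₂ : H}
    (h : P.Step U₁ V₁ lam₁ U₂ V₂ lam₂)
    (s1 : P.G U₁ V₁ + P.γ • (V₁ - U₁) + P.T lam₁ U₁ = 0)
    (g1 : P.Good U₁ V₁) (inv : ∃ W, P.comp U₂ V₁ W ≤ P.β)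
    {Bl : ℝ} (hBl : P.lag U₂ V₁ lam₁ + P.γ / 2 * ‖U₂ - U₁‖ ^ 2 ≤ Bl) (hβ : Bl < P.β) :
    (∃ W, P.comp U₂ V₂ W ≤ P.β) ∧ P.Good U₂ V₁ ∧ P.Good U₂ V₂ ∧
      P.lag U₂ V₂ lam₂ ≤ Bl - P.ν * (‖U₂ - U₁‖ ^ 2 + ‖V₂ - V₁‖ ^ 2) := by
  obtain ⟨W, hW⟩ := P.exists_comp_le_next g1 s1 inv hBl h.minV
  have g21 := (P.good_of_comp_le inv.choose_spec).1
  have g2 := (P.good_of_comp_le (hW.trans hβ.le)).1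
  exact ⟨⟨W, hW.trans hβ.le⟩, g21, g2, h.descent g1 g21 g2 s1 hBl⟩

/-- The invariant of the iteration. -/
structure Inv (P : BilinearProblem E H) (U V : E) (lam : H) : Prop where
  comp_le : ∃ W, P.comp U V W ≤ P.β
  stat : P.G U V + P.γ • (V - U) + P.T lam U = 0
  lag_lt : P.lag U V lam < P.β

lemma Inv.good [Nontrivial H] {U V : E} {lam : H} (h : P.Inv U V lam) : P.Good U V :=
  (P.good_of_comp_le h.comp_le.choose_spec).1

lemma Inv.next [Nontrivial H] {U₁ V₁ U₂ V₂ : E} {lam₁ lam₂ : H} (hI : P.Inv U₁ V₁ lam₁)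
    (h : P.Step U₁ V₁ lam₁ U₂ V₂ lam₂) :
    P.Inv U₂ V₂ lam₂ ∧ P.Good U₂ V₁ ∧
      P.lag U₂ V₂ lam₂ ≤ P.lag U₁ V₁ lam₁ - P.ν * (‖U₂ - U₁‖ ^ 2 + ‖V₂ - V₁‖ ^ 2) := by
  have hρ := P.ρ_pos
  have hν := P.ν_pos
  have hU := h.lag_le_left U₁
  have k : 0 ≤ P.ρ / 2 * ‖P.res U₂ V₁ - P.res U₁ V₁‖ ^ 2 := by positivity
  obtain ⟨c, g21, g2, hd⟩ := h.next hI.stat hI.good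
    (P.exists_comp_le_of_min hI.stat hI.comp_le hI.lag_lt h.minU)
    (Bl := P.lag U₁ V₁ lam₁) (by linarith) hI.lag_lt
  have k2 : 0 ≤ P.ν * (‖U₂ - U₁‖ ^ 2 + ‖V₂ - V₁‖ ^ 2) := by positivity
  exact ⟨⟨c, h.stationary, by linarith [hI.lag_lt]⟩, g21, hd⟩

variable (P)

lemma comp_self (U V : E) : P.comp U V V = P.φ U V + P.γ / 2 * ‖U - V‖ ^ 2
    + P.ρ / 4 * ‖P.res U V‖ ^ 2 := by
  rw [comp_eq]; simp

lemma comp_self_symm (U V : E) : P.comp U V V = P.comp V U U := by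
  rw [comp_self, comp_self, P.φ_symm, norm_sub_rev, P.res_symm]

lemma comp_self_le_lag (U V : E) (θ : H) : P.comp U V V ≤ P.lag U V θ + 1 / P.ρ * ‖θ‖ ^ 2 := by
  have hρ := P.ρ_pos
  have h3 : 0 ≤ 1 / P.ρ * ‖θ + (P.ρ / 2) • P.res U V‖ ^ 2 := by positivity
  rw [norm_add_sq_real, inner_smul_right, norm_smul, mul_pow, Real.norm_eq_abs, sq_abs] at h3
  have h4 : 1 / P.ρ * (‖θ‖ ^ 2 + 2 * (P.ρ / 2 * inner ℝ θ (P.res U V))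
      + (P.ρ / 2) ^ 2 * ‖P.res U V‖ ^ 2)
      = 1 / P.ρ * ‖θ‖ ^ 2 + inner ℝ θ (P.res U V) + P.ρ / 4 * ‖P.res U V‖ ^ 2 := by
    field_simp; ring
  rw [h4] at h3
  rw [comp_self, lag]
  linarith

lemma path_form_le (l₀ l₁ m : H) {t : ℝ} (h0 : 0 ≤ t) (h1 : t ≤ 1) :
    -(1 / 2) * ‖l₁ - m‖ ^ 2 - 1 / 2 * ‖l₀ + m‖ ^ 2 + 1 / 4 * ‖m + (l₀ + t • (l₁ - l₀))‖ ^ 2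
      ≤ t * inner ℝ m l₁ := by
  have k1 : 0 ≤ t * (1 - t) * ‖l₁ - l₀‖ ^ 2 :=
    mul_nonneg (mul_nonneg h0 (by linarith)) (sq_nonneg _)
  have k2 : 0 ≤ (1 + t) * ‖l₀ + m‖ ^ 2 := by positivity
  have k3 : 0 ≤ (2 - t) * ‖l₁ - m‖ ^ 2 := mul_nonneg (by linarith) (sq_nonneg _)
  simp only [norm_add_sq_real, norm_sub_sq_real, norm_smul, inner_smul_right,
    inner_add_right, inner_sub_right, mul_pow, Real.norm_eq_abs, sq_abs,
    real_inner_comm l₁ m, real_inner_comm l₀ m, real_inner_comm l₀ l₁,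
    real_inner_self_eq_norm_sq] at k1 k2 k3 ⊢
  linarith

lemma lag_min_lipschitz {V x y : E} {θ₁ θ₂ : H} (hx : ∀ z, P.lag V x θ₁ ≤ P.lag V z θ₁)
    (hy : ∀ z, P.lag V y θ₂ ≤ P.lag V z θ₂) :
    ‖x - y‖ ≤ P.s * ‖V‖ / P.γ * ‖θ₁ - θ₂‖ := by
  have hρ := P.ρ_pos
  have hγ := P.γ_pos
  have m1 := P.obj_min (U := V) (Z := 0) (ω := 0) (κ := P.ρ)
    (by simpa only [lag_eq_obj P V 0] using hx) y
  have m2 := P.obj_min (U := V) (Z := 0) (ω := 0) (κ := P.ρ)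
    (by simpa only [lag_eq_obj P V 0] using hy) x
  rw [← lag_eq_obj, ← lag_eq_obj, add_zero, lag, lag] at m1 m2
  rw [norm_sub_rev y x] at m2
  have k1 : 0 ≤ P.ρ / 2 * ‖P.res V x - P.res V y‖ ^ 2 := by positivity
  have k2 : 0 ≤ P.ρ / 2 * ‖P.res V y - P.res V x‖ ^ 2 := by positivity
  have e : inner ℝ (θ₂ - θ₁) (P.B V (x - y)) = inner ℝ θ₁ (P.res V y) + inner ℝ θ₂ (P.res V x)
      - inner ℝ θ₁ (P.res V x) - inner ℝ θ₂ (P.res V y) := by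
    rw [← res_sub, inner_sub_left, inner_sub_right, inner_sub_right]; ring
  have h : P.γ * ‖x - y‖ ^ 2 ≤ P.s * ‖θ₁ - θ₂‖ * ‖V‖ * ‖x - y‖ := by
    calc P.γ * ‖x - y‖ ^ 2 ≤ inner ℝ (θ₂ - θ₁) (P.B V (x - y)) := by rw [e]; linarith
      _ = inner ℝ (P.T (θ₂ - θ₁) V) (x - y) := (P.T_adj _ _ _).symm
      _ ≤ ‖P.T (θ₂ - θ₁) V‖ * ‖x - y‖ := real_inner_le_norm _ _
      _ ≤ _ := by
        rw [norm_sub_rev θ₁ θ₂]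
        exact mul_le_mul_of_nonneg_right (P.T_le _ _) (norm_nonneg _)
  rcases (norm_nonneg (x - y)).eq_or_lt with h0 | h0
  · rw [← h0]
    have := P.s_nonneg
    positivity
  · rw [div_mul_eq_mul_div, le_div_iff₀ hγ]
    refine le_of_mul_le_mul_right ?_ h0
    linarith

lemma comp_self_next [Nontrivial H] {U₁ V₁ U₂ : E} {lam₀ lam₁ : H}
    (hF : P.lag U₁ V₁ lam₀ + 1 / P.ρ * ‖lam₀‖ ^ 2 ≤ P.β₀)
    (hlam : lam₁ = lam₀ + P.ρ • P.res U₁ V₁) (hM : ‖lam₁‖ ≤ P.M)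
    (hU : ∀ U, P.lag U₂ V₁ lam₁ ≤ P.lag U V₁ lam₁) :
    P.comp U₂ V₁ V₁ < P.β ∧ ‖lam₁ + P.ρ • P.res U₂ V₁‖ ≤ P.M := by
  have hρ := P.ρ_pos
  have hγ := P.γ_pos
  have hml := P.mult_lt
  change P.M ^ 2 / P.ρ < _ at hml
  set θ : ℝ → H := fun t => lam₀ + t • (lam₁ - lam₀)
  choose u hu using fun t => P.exists_lag_min V₁ (θ t)
  have hcont : Continuous u := by
    refine continuous_iff_continuousAt.2 fun t => ?_
    rw [ContinuousAt, tendsto_iff_norm_sub_tendsto_zero]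
    refine squeeze_zero (fun _ => norm_nonneg _)
      (fun τ => P.lag_min_lipschitz (hu τ) (hu t)) ?_
    have : Continuous fun τ => P.s * ‖V₁‖ / P.γ * ‖θ τ - θ t‖ := by fun_prop
    simpa using this.tendsto t
  have hgc : Continuous fun t => P.comp (u t) V₁ V₁ :=
    P.comp_cont.comp (hcont.prodMk (continuous_const (y := (V₁, V₁))))
  have hmin : ∀ t X, P.lag (u t) V₁ (θ t) + P.γ / 2 * ‖u t - X‖ ^ 2
      + P.ρ / 2 * ‖P.res (u t) V₁ - P.res X V₁‖ ^ 2 ≤ P.lag X V₁ (θ t) := by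
    intro t X
    have := P.obj_min (U := V₁) (Z := 0) (ω := 0) (κ := P.ρ)
      (by simpa only [lag_eq_obj P V₁ 0] using hu t) X
    rw [← lag_eq_obj, ← lag_eq_obj, add_zero, P.lag_symm, P.lag_symm _ X, P.res_symm,
      P.res_symm _ X] at this
    linarith
  have hmult : ∀ t, P.comp (u t) V₁ V₁ ≤ P.β → ‖θ t + P.ρ • P.res (u t) V₁‖ ≤ P.M := by
    intro t ht
    rw [comp_self_symm] at ht
    refine P.mult_le (P.good_of_comp_le ht).1 (P.stationary_V (hu t) ?_)
    rw [P.res_symm]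
  have hstep : ∀ t, 0 ≤ t → t ≤ 1 → P.comp (u t) V₁ V₁ ≤ P.β →
      P.comp (u t) V₁ V₁ ≤ P.β₀ + P.M ^ 2 / P.ρ := by
    intro t h0 h1 ht
    have hm := hmult t ht
    have hX := hmin t U₁
    have hpf := path_form_le lam₀ lam₁ (θ t + P.ρ • P.res (u t) V₁) h0 h1
    have hi : t * inner ℝ (θ t + P.ρ • P.res (u t) V₁) lam₁ ≤ P.M ^ 2 := by
      have k1 := (real_inner_le_norm (θ t + P.ρ • P.res (u t) V₁) lam₁).trans
        (mul_le_mul hm hM (norm_nonneg _) P.M_pos.le)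
      rw [← sq] at k1
      nlinarith [sq_nonneg P.M]
    have k0 : 0 ≤ P.γ / 2 * ‖u t - U₁‖ ^ 2 := by positivity
    have key : P.ρ * (P.comp (u t) V₁ V₁ - P.β₀) ≤ P.M ^ 2 := by
      refine le_trans ?_ (hpf.trans hi)
      have e1 : P.ρ * (1 / P.ρ * ‖lam₀‖ ^ 2) = ‖lam₀‖ ^ 2 := by field_simp
      have hF' := mul_le_mul_of_nonneg_left hF hρ.le
      have hX' : P.ρ * (P.lag (u t) V₁ (θ t) + P.ρ / 2 * ‖P.res (u t) V₁ - P.res U₁ V₁‖ ^ 2)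
          ≤ P.ρ * P.lag U₁ V₁ (θ t) := mul_le_mul_of_nonneg_left (by linarith) hρ.le
      rw [mul_add, e1] at hF'
      rw [comp_self]
      have hdiff : lam₁ - lam₀ = P.ρ • P.res U₁ V₁ := by rw [hlam]; abel
      simp only [lag, θ, hdiff] at hF' hX' ⊢
      rw [hlam]
      generalize P.res U₁ V₁ = x at *
      generalize P.res (u t) V₁ = y at *
      simp only [norm_add_sq_real, norm_sub_sq_real, norm_smul, inner_smul_right, inner_smul_left,
        inner_add_right, inner_add_left, mul_pow,
        Real.norm_eq_abs, sq_abs, real_inner_comm x lam₀, real_inner_comm y lam₀,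
        real_inner_comm y x, conj_trivial, real_inner_self_eq_norm_sq] at hF' hX' ⊢
      linarith
    have := (le_div_iff₀' hρ).2 key
    linarith
  have h0 : P.comp (u 0) V₁ V₁ ≤ P.β₀ := by
    have k1 := P.comp_self_le_lag (u 0) V₁ lam₀
    have k2 := hmin 0 U₁
    have k3 : 0 ≤ P.γ / 2 * ‖u 0 - U₁‖ ^ 2 := by positivity
    have k4 : 0 ≤ P.ρ / 2 * ‖P.res (u 0) V₁ - P.res U₁ V₁‖ ^ 2 := by positivity
    simp only [θ, zero_smul, add_zero] at k2
    linarith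
  have hMρ : 0 ≤ P.M ^ 2 / P.ρ := by positivity
  have h1 : P.comp (u 1) V₁ V₁ ≤ P.β₀ + P.M ^ 2 / P.ρ := by
    by_contra hcon
    push Not at hcon
    set c := min (P.comp (u 1) V₁ V₁) P.β
    have hc : P.β₀ + P.M ^ 2 / P.ρ < c := lt_min hcon (by linarith)
    obtain ⟨t, ht, hte⟩ := intermediate_value_Icc (zero_le_one' ℝ) hgc.continuousOn
      (⟨by linarith, min_le_left _ _⟩ : c ∈ Set.Icc _ _)
    have := hstep t ht.1 ht.2 (hte.le.trans (min_le_right _ _))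
    exact absurd (hte.ge.trans this) (not_le.2 hc)
  have e1 : θ 1 = lam₁ := by simp [θ]
  have e2 : u 1 = U₂ := by
    have := P.lag_min_lipschitz (hu 1) (y := U₂) (θ₂ := lam₁) (fun z => by
      rw [P.lag_symm, P.lag_symm _ z]; exact hU z)
    rw [e1, sub_self, norm_zero, mul_zero] at this
    exact sub_eq_zero.1 (norm_le_zero_iff.1 this)
  have hm := hmult 1 (by linarith)
  rw [e1, e2] at hm
  rw [e2] at h1
  exact ⟨by linarith, hm⟩

variable {P}

lemma Step.inv_second [Nontrivial H] {U₀ V₀ U₁ V₁ U₂ V₂ : E} {lam₀ lam₁ lam₂ : H}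
    (h1 : P.Step U₀ V₀ lam₀ U₁ V₁ lam₁) (h2 : P.Step U₁ V₁ lam₁ U₂ V₂ lam₂)
    (hinit : P.lag U₀ V₀ lam₀ + 1 / P.ρ * ‖lam₀‖ ^ 2 ≤ P.β₀) : P.Inv U₂ V₂ lam₂ := by
  have hρ := P.ρ_pos
  have hγ := P.γ_pos
  have hν := P.ν_pos
  have hml := P.mult_lt
  change P.M ^ 2 / P.ρ < _ at hml
  have hMρ : 0 ≤ P.M ^ 2 / P.ρ := by positivity
  have hF : P.lag U₁ V₁ lam₀ + 1 / P.ρ * ‖lam₀‖ ^ 2 ≤ P.β₀ := by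
    linarith [h1.minV V₀, h1.minU U₀]
  have hc := (P.comp_self_le_lag U₁ V₁ lam₀).trans hF
  have g1 := (P.good_of_comp_le (hc.trans (by linarith))).1
  have s1 := h1.stationary
  have hM := P.mult_le g1 s1
  obtain ⟨hc2, hm⟩ := P.comp_self_next hF h1.upd hM h2.minU
  have hU := h2.lag_le_left U₁
  have hBl : P.lag U₁ V₁ lam₁ - P.ρ / 2 * ‖P.res U₂ V₁ - P.res U₁ V₁‖ ^ 2 < P.β := by
    have key : P.ρ * (P.lag U₁ V₁ lam₁ - P.ρ / 2 * ‖P.res U₂ V₁ - P.res U₁ V₁‖ ^ 2 - P.β₀)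
        ≤ P.M ^ 2 := by
      refine le_trans ?_ (pow_le_pow_left₀ (norm_nonneg _) hm 2)
      have e1 : P.ρ * (1 / P.ρ * ‖lam₀‖ ^ 2) = ‖lam₀‖ ^ 2 := by field_simp
      have hF' := mul_le_mul_of_nonneg_left hF hρ.le
      rw [mul_add, e1] at hF'
      have k1 : 0 ≤ ‖P.ρ • P.res U₂ V₁‖ ^ 2 := sq_nonneg _
      have k2 : 0 ≤ ‖lam₀ + (lam₁ + P.ρ • P.res U₂ V₁)‖ ^ 2 := sq_nonneg _
      rw [h1.upd] at k2 ⊢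
      simp only [lag] at hF' ⊢
      generalize P.res U₁ V₁ = x at *
      generalize P.res U₂ V₁ = y at *
      simp only [norm_add_sq_real, norm_sub_sq_real, norm_smul, inner_smul_right, inner_smul_left,
        inner_add_right, inner_add_left, mul_pow,
        Real.norm_eq_abs, sq_abs, real_inner_comm x lam₀, real_inner_comm y lam₀,
        real_inner_comm y x, conj_trivial, real_inner_self_eq_norm_sq] at hF' k1 k2 ⊢
      linarith
    have := (le_div_iff₀' hρ).2 key
    linarith
  obtain ⟨c, -, -, hd⟩ := h2.next s1 g1 ⟨V₁, hc2.le⟩ (by linarith) hBl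
  have k2 : 0 ≤ P.ν * (‖U₂ - U₁‖ ^ 2 + ‖V₂ - V₁‖ ^ 2) := by positivity
  exact ⟨c, h2.stationary, by linarith⟩

end BilinearProblem

lemma one_add_rpow_le {s q : ℝ} (h0 : 0 ≤ s) (h1 : s ≤ 1) (hq : 1 ≤ q) :
    (1 + s) ^ q ≤ 1 + s * (2 ^ q - 1) := by
  have := (convexOn_rpow hq).2 (x := 1) (y := 2) (by norm_num) (by norm_num)
    (sub_nonneg.2 h1) h0 (by ring)
  simp only [smul_eq_mul, Real.one_rpow] at this
  rw [show (1 - s) * 1 + s * 2 = 1 + s by ring] at this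
  linarith

lemma rpow_sub_rpow_ge {x y α : ℝ} (hx : 0 < x) (hy : 0 ≤ y) (h0 : 0 ≤ α) (h1 : α ≤ 1) :
    (1 - α) * (x - y) ≤ x ^ α * (x ^ (1 - α) - y ^ (1 - α)) := by
  have hb := rpow_one_add_le_one_add_mul_self (s := y / x - 1) (p := 1 - α)
    (by have : 0 ≤ y / x := by positivity
        linarith) (by linarith) (by linarith)
  rw [add_sub_cancel, Real.div_rpow hy hx.le, div_le_iff₀ (by positivity)] at hb
  have e : x ^ α * x ^ (1 - α) = x := by
    rw [← Real.rpow_add hx, add_sub_cancel, Real.rpow_one]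
  have h2 := mul_le_mul_of_nonneg_left hb (Real.rpow_nonneg hx.le α)
  have e2 : x ^ α * ((1 + (1 - α) * (y / x - 1)) * x ^ (1 - α))
      = (1 + (1 - α) * (y / x - 1)) * x := by
    rw [mul_left_comm, e]
  rw [e2] at h2
  have e3 : (1 + (1 - α) * (y / x - 1)) * x = x + (1 - α) * (y - x) := by
    field_simp
  rw [mul_sub (x ^ α), e]
  linarith

lemma value_rate {Δ : ℕ → ℝ} {K α : ℝ} (h0 : 1 / 2 < α) (h1 : α < 1) (hK : 0 < K)
    (hdec : ∀ k, Δ (k + 1) ^ (2 * α) ≤ K * (Δ k - Δ (k + 1))) :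
    ∃ C, 0 < C ∧ ∀ k : ℕ, 1 ≤ k → Δ k ≤ C * (k : ℝ) ^ (-(1 / (2 * α - 1))) := by
  have hα : 0 < 2 * α - 1 := by linarith
  set q := 1 / (2 * α - 1) with hq
  have hq1 : 1 ≤ q := by
    rw [hq, le_div_iff₀ hα]; linarith
  have hq0 : 0 < q := by linarith
  set C₀ := (2 * K * 2 ^ q) ^ q
  have hC₀ : 0 < C₀ := by positivity
  set C := max C₀ (Δ 1)
  have hC : 0 < C := lt_max_of_lt_left hC₀
  have hCα : 2 * K * 2 ^ q ≤ C ^ (2 * α - 1) := by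
    have h2 : C₀ ^ (2 * α - 1) = 2 * K * 2 ^ q := by
      rw [← Real.rpow_mul (by positivity), hq, one_div_mul_cancel hα.ne', Real.rpow_one]
    rw [← h2]
    exact Real.rpow_le_rpow hC₀.le (le_max_left _ _) hα.le
  refine ⟨C, hC, fun k hk => ?_⟩
  induction k, hk using Nat.le_induction with
  | base =>
    rw [Nat.cast_one, Real.one_rpow, mul_one]
    exact le_max_right _ _
  | succ k hk ih =>
    by_contra hcon
    push Not at hcon
    have hk0 : (0 : ℝ) < k := by exact_mod_cast hk
    have hk1 : (0 : ℝ) < ((k + 1 : ℕ) : ℝ) := by positivity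
    have hkc : ((k + 1 : ℕ) : ℝ) = k + 1 := by push_cast; ring
    set x := ((k + 1 : ℕ) : ℝ)
    have hx : 0 < C * x ^ (-q) := by positivity
    have a1 : (C * x ^ (-q)) ^ (2 * α) ≤ Δ (k + 1) ^ (2 * α) :=
      Real.rpow_le_rpow hx.le hcon.le (by linarith)
    have a2 := hdec k
    have a3 : (C * x ^ (-q)) ^ (2 * α) = C ^ (2 * α - 1) * C * (x ^ (-q) * x⁻¹) := by
      rw [Real.mul_rpow hC.le (by positivity), ← Real.rpow_mul hk1.le]
      congr 1
      · rw [← Real.rpow_add_one hC.ne', sub_add_cancel]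
      · rw [← Real.rpow_neg_one x, ← Real.rpow_add hk1]
        congr 1
        rw [hq]; field_simp; ring
    have a4 : K * (Δ k - Δ (k + 1)) < K * (C * (k : ℝ) ^ (-q) - C * x ^ (-q)) :=
      mul_lt_mul_of_pos_left (by linarith) hK
    have a5 : (k : ℝ) ^ (-q) ≤ x ^ (-q) * (1 + 1 / k * (2 ^ q - 1)) := by
      have b := one_add_rpow_le (s := 1 / (k : ℝ)) (by positivity)
        (by rw [div_le_one hk0]; exact_mod_cast hk) hq1
      refine le_trans (le_of_eq ?_) (mul_le_mul_of_nonneg_left b (by positivity))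
      rw [show 1 + 1 / (k : ℝ) = x / k by rw [hkc]; field_simp, Real.div_rpow hk1.le hk0.le,
        Real.rpow_neg hk1.le, Real.rpow_neg hk0.le]
      field_simp
    have a6 : C ^ (2 * α - 1) * C * (x ^ (-q) * x⁻¹)
        < K * C * x ^ (-q) * (1 / k * (2 ^ q - 1)) := by
      have := mul_le_mul_of_nonneg_left a5 (mul_pos hK hC).le
      rw [a3] at a1
      linarith
    have a7 : C ^ (2 * α - 1) * x⁻¹ < K * (1 / k * (2 ^ q - 1)) := by
      refine lt_of_mul_lt_mul_left ?_ hx.le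
      linarith
    have a8 : 2 * K * 2 ^ q * x⁻¹ ≤ C ^ (2 * α - 1) * x⁻¹ :=
      mul_le_mul_of_nonneg_right hCα (by positivity)
    have a9 : 1 / (k : ℝ) ≤ 2 * x⁻¹ := by
      rw [← div_eq_mul_inv, div_le_div_iff₀ hk0 hk1, hkc]
      have : (1 : ℝ) ≤ k := by exact_mod_cast hk
      linarith
    have h2q : (0 : ℝ) < 2 ^ q := by positivity
    have a10 : K * (1 / k * (2 ^ q - 1)) ≤ 2 * K * 2 ^ q * x⁻¹ := by
      have c1 : 1 / (k : ℝ) * (2 ^ q - 1) ≤ 1 / k * 2 ^ q :=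
        mul_le_mul_of_nonneg_left (by linarith) (by positivity)
      have c2 := mul_le_mul_of_nonneg_right a9 h2q.le
      have c3 := mul_le_mul_of_nonneg_left (c1.trans c2) hK.le
      linarith
    linarith

/-- Descent together with a Łojasiewicz inequality of exponent `α ∈ (1/2, 1)` makes the tails of the
step lengths decay at a polynomial rate. -/
lemma tail_rate {Δ d : ℕ → ℝ} {K α : ℝ} (h0 : 1 / 2 < α) (h1 : α < 1) (hK : 0 < K)
    (hΔ : ∀ k, 0 ≤ Δ k) (hd : ∀ k, 0 ≤ d k) (hdec : ∀ k, d k ^ 2 ≤ K * (Δ k - Δ (k + 1)))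
    (hKL : ∀ k, Δ (k + 1) ^ α ≤ K * d k) :
    ∃ C, 0 < C ∧ ∀ k : ℕ, 1 ≤ k → ∀ n, ∑ j ∈ Finset.range n, d (k + 1 + j)
      ≤ C * (k : ℝ) ^ (-(1 - α) / (2 * α - 1)) := by
  have hα : 0 < 2 * α - 1 := by linarith
  have hmono : ∀ k, Δ (k + 1) ≤ Δ k := fun k => by
    have := (sq_nonneg _).trans (hdec k)
    linarith [nonneg_of_mul_nonneg_right this hK]
  obtain ⟨C, hC, hrate⟩ := value_rate (Δ := Δ) (K := K ^ 3) h0 h1 (by positivity) (fun k => by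
    rw [mul_comm 2 α, Real.rpow_mul (hΔ _), Real.rpow_two]
    have a := pow_le_pow_left₀ (Real.rpow_nonneg (hΔ _) _) (hKL k) 2
    have b := mul_le_mul_of_nonneg_left (hdec k) (sq_nonneg K)
    linarith)
  set q := 1 / (2 * α - 1) with hq
  have hq0 : 0 < q := by positivity
  set K' := K ^ 2 / (1 - α) with hK'
  have hα1 : 0 < 1 - α := by linarith
  have hK'0 : 0 < K' := by positivity
  set ψ : ℕ → ℝ := fun k => Δ k ^ (1 - α)
  have hψ : ∀ k, 0 ≤ ψ k := fun k => Real.rpow_nonneg (hΔ k) _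
  have hψm : ∀ k, ψ (k + 1) ≤ ψ k := fun k => Real.rpow_le_rpow (hΔ _) (hmono k) hα1.le
  have hstep : ∀ k, 2 * d (k + 1) ≤ d k + K' * (ψ (k + 1) - ψ (k + 2)) := by
    intro k
    have hψd : 0 ≤ ψ (k + 1) - ψ (k + 2) := by linarith [hψm (k + 1)]
    have hsq : d (k + 1) ^ 2 ≤ d k * (K' * (ψ (k + 1) - ψ (k + 2))) := by
      have a := hdec (k + 1)
      rcases (hΔ (k + 1)).eq_or_lt with hz | hz
      · have h3 := hΔ (k + 1 + 1)
        rw [← hz] at a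
        have : 0 ≤ d k * (K' * (ψ (k + 1) - ψ (k + 2))) := by
          have := hd k
          positivity
        nlinarith
      · have b := rpow_sub_rpow_ge hz (hΔ (k + 2)) (by linarith) h1.le
        have c := mul_le_mul_of_nonneg_right (hKL k) hψd
        have e : (1 - α) * (Δ (k + 1) - Δ (k + 2)) ≤ K * d k * (ψ (k + 1) - ψ (k + 2)) :=
          b.trans c
        have e2 := mul_le_mul_of_nonneg_left e hK.le
        rw [hK', div_mul_eq_mul_div, ← mul_div_assoc, le_div_iff₀ hα1]
        have a' := mul_le_mul_of_nonneg_right a hα1.le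
        linarith
    have hA := hd k
    have hB : 0 ≤ K' * (ψ (k + 1) - ψ (k + 2)) := by positivity
    refine abs_le_of_sq_le_sq' ?_ (by positivity) |>.2
    nlinarith [sq_nonneg (d k - K' * (ψ (k + 1) - ψ (k + 2)))]
  have hsum : ∀ k n, ∑ j ∈ Finset.range n, d (k + 1 + j)
      ≤ d k + K' * (ψ (k + 1) - ψ (k + 1 + n)) - d (k + n) := by
    intro k n
    induction n with
    | zero => simp
    | succ n ih =>
      rw [Finset.sum_range_succ]
      have := hstep (k + n)
      rw [show k + n + 1 = k + 1 + n by ring, show k + n + 2 = k + 1 + (n + 1) by ring] at this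
      rw [show k + (n + 1) = k + 1 + n by ring]
      linarith
  refine ⟨√(K * C) + K' * C ^ (1 - α), by positivity, fun k hk n => ?_⟩
  have hk1 : (1 : ℝ) ≤ k := by exact_mod_cast hk
  have hk0 : (0 : ℝ) < k := by linarith
  have hexp : -(1 - α) / (2 * α - 1) = -q * (1 - α) := by rw [hq]; ring
  have b1 : d k ≤ √(K * C) * (k : ℝ) ^ (-(1 - α) / (2 * α - 1)) := by
    have c1 : d k ^ 2 ≤ K * C * (k : ℝ) ^ (-q) := by
      have := mul_le_mul_of_nonneg_left ((sub_le_self _ (hΔ (k + 1))).trans (hrate k hk)) hK.le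
      linarith [hdec k]
    have c2 : (k : ℝ) ^ (-q) ≤ ((k : ℝ) ^ (-q * (1 - α))) ^ 2 := by
      rw [← Real.rpow_natCast, ← Real.rpow_mul hk0.le]
      refine Real.rpow_le_rpow_of_exponent_le hk1 ?_
      push_cast
      nlinarith
    rw [hexp]
    refine (abs_le_of_sq_le_sq' ?_ (by positivity)).2
    rw [mul_pow, Real.sq_sqrt (by positivity)]
    exact c1.trans (mul_le_mul_of_nonneg_left c2 (by positivity))
  have b2 : ψ (k + 1) ≤ C ^ (1 - α) * (k : ℝ) ^ (-(1 - α) / (2 * α - 1)) := by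
    refine (hψm k).trans ((Real.rpow_le_rpow (hΔ k) (hrate k hk) hα1.le).trans (le_of_eq ?_))
    rw [Real.mul_rpow hC.le (by positivity), ← Real.rpow_mul hk0.le, hexp]
  have b3 := mul_le_mul_of_nonneg_left b2 hK'0.le
  have b4 := mul_nonneg hK'0.le (hψ (k + 1 + n))
  have := hsum k n
  linarith [hd (k + n)]

open Filter Topology in
/-- If the gradient measure `g` tends to zero along a sequence in a compact set on which the values
of `F` converge, then the sequence approaches the zeros of `g` at the limiting level. -/
lemma eventually_exists_near_zero {Z : Type*} [PseudoMetricSpace Z] {F g : Z → ℝ}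
    (hF : Continuous F) (hg : Continuous g) {K : Set Z} (hK : IsCompact K) {z : ℕ → Z}
    (hz : ∀ k, z k ∈ K) {l : ℝ} (hFl : Tendsto (fun k => F (z k)) atTop (𝓝 l))
    (hgl : Tendsto (fun k => g (z k)) atTop (𝓝 0)) {ε : ℝ} (hε : 0 < ε) :
    ∀ᶠ k in atTop, ∃ y, g y = 0 ∧ F y = l ∧ dist (z k) y ≤ ε := by
  by_contra hcon
  obtain ⟨φ, hφ, hbad⟩ := extraction_of_frequently_atTop (not_eventually.1 hcon)
  obtain ⟨y, -, ψ, hψ, hy⟩ := hK.tendsto_subseq fun k => hz (φ k)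
  have ht := (hφ.comp hψ).tendsto_atTop
  have h1 := tendsto_nhds_unique ((hg.tendsto y).comp hy) (hgl.comp ht)
  have h2 := tendsto_nhds_unique ((hF.tendsto y).comp hy) (hFl.comp ht)
  obtain ⟨k, hk⟩ := (Metric.tendsto_nhds.1 hy ε hε).exists
  exact hbad (ψ k) ⟨y, h1, h2, hk.le⟩

open Filter Topology in
/-- Sublinear convergence of a descent sequence under a Łojasiewicz inequality with exponent in
`(1/2, 1)`. -/
lemma exists_dist_zero_le {Z : Type*} [PseudoMetricSpace Z] {F g : Z → ℝ} (hF : Continuous F)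
    (hg : Continuous g) (hg0 : ∀ x, 0 ≤ g x) {K : Set Z} (hK : IsCompact K) {z : ℕ → Z}
    (hz : ∀ k, z k ∈ K) {d : ℕ → ℝ} (hd : ∀ k, 0 ≤ d k) {C : ℝ} (hC : 0 < C)
    (hdist : ∀ k, dist (z k) (z (k + 1)) ≤ C * d k)
    (hdec : ∀ k, d k ^ 2 ≤ C * (F (z k) - F (z (k + 1)))) (hgd : ∀ k, g (z (k + 1)) ≤ C * d k)
    {α : ℝ} (h0 : 1 / 2 < α) (h1 : α < 1) {c ε : ℝ} (hc : 0 < c) (hε : 0 < ε)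
    (hKL : ∀ x y, g y = 0 → dist x y ≤ ε → |F x - F y| ^ α ≤ c * g x) :
    ∃ (k₀ : ℕ) (ξ : ℝ), 0 < ξ ∧ ∀ k : ℕ, k₀ < k →
      ∃ y, g y = 0 ∧ dist (z k) y ≤ ξ * ((k : ℝ) - k₀) ^ (-(1 - α) / (2 * α - 1)) := by
  have hanti : Antitone fun k => F (z k) := antitone_nat_of_succ_le fun k => by
    have := (sq_nonneg _).trans (hdec k)
    linarith [nonneg_of_mul_nonneg_right this hC]
  have hbdd : BddBelow (Set.range fun k => F (z k)) := by
    refine (hK.image hF).bddBelow.mono ?_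
    rintro _ ⟨k, rfl⟩
    exact ⟨z k, hz k, rfl⟩
  set l := ⨅ k, F (z k)
  have hFl : Tendsto (fun k => F (z k)) atTop (𝓝 l) := tendsto_atTop_ciInf hanti hbdd
  have hle : ∀ k, l ≤ F (z k) := fun k => ciInf_le hbdd k
  have hFl' := (tendsto_add_atTop_iff_nat 1).2 hFl
  have hd0 : Tendsto d atTop (𝓝 0) := by
    have h2 : Tendsto (fun k => √(C * (F (z k) - F (z (k + 1))))) atTop (𝓝 0) := by
      simpa using ((hFl.sub hFl').const_mul C).sqrt
    exact squeeze_zero hd (fun k => Real.le_sqrt_of_sq_le (hdec k)) h2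
  have hgl : Tendsto (fun k => g (z k)) atTop (𝓝 0) := by
    rw [← tendsto_add_atTop_iff_nat 1]
    refine squeeze_zero (fun k => hg0 _) hgd ?_
    simpa using hd0.const_mul C
  obtain ⟨N, hN⟩ := eventually_atTop.1 (eventually_exists_near_zero hF hg hK hz hFl hgl hε)
  obtain ⟨y, -, ψ, hψ, hy⟩ := hK.tendsto_subseq hz
  have hgy := tendsto_nhds_unique ((hg.tendsto y).comp hy) (hgl.comp hψ.tendsto_atTop)
  obtain ⟨R, hR, hrate⟩ := tail_rate (Δ := fun k => F (z (N + k)) - l) (d := fun k => d (N + k))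
    (K := max C (c * C)) h0 h1 (lt_max_of_lt_left hC) (fun k => sub_nonneg.2 (hle _))
    (fun k => hd _)
    (fun k => by
      rw [sub_sub_sub_cancel_right]
      refine (hdec (N + k)).trans (mul_le_mul_of_nonneg_right (le_max_left _ _) ?_)
      exact sub_nonneg.2 (hanti (Nat.le_succ _)))
    (fun k => by
      obtain ⟨w, hw, hFw, hzw⟩ := hN (N + (k + 1)) (Nat.le_add_right _ _)
      have h2 := hKL _ w hw hzw
      rw [hFw, abs_of_nonneg (sub_nonneg.2 (hle _))] at h2
      have h3 := mul_le_mul_of_nonneg_left (hgd (N + k)) hc.le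
      rw [← mul_assoc] at h3
      exact h2.trans (h3.trans (mul_le_mul_of_nonneg_right (le_max_right _ _) (hd _))))
  refine ⟨N + 1, C * R, by positivity, fun k hk => ⟨y, hgy, ?_⟩⟩
  obtain ⟨j, hj, rfl⟩ : ∃ j, 1 ≤ j ∧ k = N + j + 1 := ⟨k - (N + 1), by omega, by omega⟩
  have hcast : ((N + j + 1 : ℕ) : ℝ) - ((N + 1 : ℕ) : ℝ) = j := by push_cast; ring
  rw [hcast]
  refine le_of_tendsto (tendsto_const_nhds.dist hy) ?_
  filter_upwards [hψ.tendsto_atTop.eventually_ge_atTop (N + j + 1)] with i hi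
  obtain ⟨n, hn⟩ := Nat.exists_eq_add_of_le hi
  rw [Function.comp_apply, hn]
  have h2 := dist_le_range_sum_dist (fun i => z (N + j + 1 + i)) n
  refine h2.trans ((Finset.sum_le_sum fun i _ => hdist (N + j + 1 + i)).trans ?_)
  rw [← Finset.mul_sum, mul_assoc]
  refine mul_le_mul_of_nonneg_left (le_trans (le_of_eq ?_) (hrate j hj n)) hC.le
  exact Finset.sum_congr rfl fun i _ => by rw [← add_assoc, ← add_assoc]

namespace BilinearProblem

variable {E H : Type*} [NormedAddCommGroup E] [InnerProductSpace ℝ E]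
  [NormedAddCommGroup H] [InnerProductSpace ℝ H] (P : BilinearProblem E H)

/-- The sum of the norms of the partial gradients of the augmented Lagrangian. -/
def gradSum (z : E × E × H) : ℝ :=
  ‖P.G z.2.1 z.1 + P.γ • (z.1 - z.2.1) + P.T (z.2.2 + P.ρ • P.res z.1 z.2.1) z.2.1‖
    + ‖P.G z.1 z.2.1 + P.γ • (z.2.1 - z.1) + P.T (z.2.2 + P.ρ • P.res z.1 z.2.1) z.1‖
    + ‖P.res z.1 z.2.1‖

lemma gradSum_nonneg (z : E × E × H) : 0 ≤ P.gradSum z := by unfold gradSum; positivity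

lemma gradSum_cont : Continuous P.gradSum := by
  have hU : Continuous fun z : E × E × H => z.1 := continuous_fst
  have hV : Continuous fun z : E × E × H => z.2.1 := continuous_fst.comp continuous_snd
  have hr : Continuous fun z : E × E × H => P.res z.1 z.2.1 := P.res_cont.comp (hU.prodMk hV)
  have hm : Continuous fun z : E × E × H => z.2.2 + P.ρ • P.res z.1 z.2.1 := by fun_prop
  have hG : Continuous fun z : E × E × H => P.G z.1 z.2.1 := P.G_cont.comp (hU.prodMk hV)
  have hG' : Continuous fun z : E × E × H => P.G z.2.1 z.1 := P.G_cont.comp (hV.prodMk hU)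
  have hT := P.T_cont.comp (hm.prodMk hU)
  have hT' := P.T_cont.comp (hm.prodMk hV)
  exact (((hG'.add ((hU.sub hV).const_smul _)).add hT').norm.add
    ((hG.add ((hV.sub hU).const_smul _)).add hT).norm).add hr.norm

lemma norm_B_le (U V : E) : ‖P.B U V‖ ≤ P.s * ‖U‖ * ‖V‖ := by
  have hs := P.s_nonneg
  rcases (norm_nonneg (P.B U V)).eq_or_lt with h | h
  · rw [← h]; positivity
  · refine le_of_mul_le_mul_left ?_ h
    have h1 := real_inner_le_norm (P.T (P.B U V) U) V
    rw [P.T_adj, real_inner_self_eq_norm_sq] at h1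
    have h2 := mul_le_mul_of_nonneg_right (P.T_le (P.B U V) U) (norm_nonneg V)
    linarith

/-- The constant bounding the gradient after a step by the length of the step. -/
def gradConst : ℝ :=
  2 * P.L * P.δ ^ 2 + P.Lf + P.γ + 3 * P.s * P.M + 2 * P.s * P.δ * (P.p / P.η + P.ρ * P.s * P.δ)
    + P.s * P.δ * (P.p / P.η) + P.p / P.η / P.ρ

variable {P}

lemma Step.gradSum_le [Nontrivial H] {U₁ V₁ U₂ V₂ : E} {lam₁ lam₂ : H}
    (h : P.Step U₁ V₁ lam₁ U₂ V₂ lam₂) (h1 : P.Inv U₁ V₁ lam₁) (g21 : P.Good U₂ V₁)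
    (h2 : P.Inv U₂ V₂ lam₂) :
    P.gradSum (U₂, V₂, lam₂) ≤ P.gradConst * (‖U₂ - U₁‖ + ‖V₂ - V₁‖) := by
  have hρ := P.ρ_pos
  have hγ := P.γ_pos
  have hη := P.η_pos
  have hδ := P.δ_pos
  have hL := P.L_pos
  have hLf := P.Lf_pos
  have hs := P.s_nonneg
  have hM := P.M_pos
  have hp := P.p_pos
  set d := ‖U₂ - U₁‖ + ‖V₂ - V₁‖ with hd
  have hd0 : 0 ≤ d := by positivity
  have hvd : ‖V₂ - V₁‖ ≤ d := by rw [hd]; linarith [norm_nonneg (U₂ - U₁)]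
  set e := P.p / P.η with he
  have he0 : 0 < e := by positivity
  have hΔ : ‖lam₂ - lam₁‖ ≤ e * d := by
    rw [he, div_mul_eq_mul_div, le_div_iff₀ hη, mul_comm]
    exact h.mult_change h1.good g21 h2.good h1.stat
  have hres : lam₂ - lam₁ = P.ρ • P.res U₂ V₂ := by rw [h.upd]; abel
  have nU := h2.good.norm_le
  have nV₁ : ‖V₁‖ ≤ 2 * P.δ := by linarith [g21.add_le, norm_nonneg U₂]
  have nV₂ : ‖V₂‖ ≤ 2 * P.δ := by linarith [h2.good.add_le, norm_nonneg U₂]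
  have sU : P.G V₁ U₂ + P.γ • (U₂ - V₁) + P.T (lam₁ + P.ρ • P.res U₂ V₁) V₁ = 0 := by
    refine P.stationary_V (θ := lam₁) (fun W => ?_) (by rw [P.res_symm])
    rw [P.lag_symm V₁, P.lag_symm V₁]
    exact h.minU W
  have bR : ‖P.res U₂ V₂‖ ≤ e / P.ρ * d := by
    rw [hres, norm_smul, Real.norm_eq_abs, abs_of_pos hρ] at hΔ
    rw [div_mul_eq_mul_div, le_div_iff₀ hρ, mul_comm]
    exact hΔ
  have bV : ‖P.G U₂ V₂ + P.γ • (V₂ - U₂) + P.T (lam₂ + P.ρ • P.res U₂ V₂) U₂‖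
      ≤ P.s * P.δ * e * d := by
    have e1 : P.G U₂ V₂ + P.γ • (V₂ - U₂) + P.T (lam₂ + P.ρ • P.res U₂ V₂) U₂
        = P.T (lam₂ - lam₁) U₂ := by
      rw [← hres, map_add, LinearMap.add_apply, ← add_assoc, h2.stat, zero_add]
    rw [e1]
    calc ‖P.T (lam₂ - lam₁) U₂‖ ≤ P.s * ‖lam₂ - lam₁‖ * ‖U₂‖ := P.T_le _ _
      _ ≤ P.s * (e * d) * P.δ := by gcongr
      _ = P.s * P.δ * e * d := by ring
  have bU : ‖P.G V₂ U₂ + P.γ • (U₂ - V₂) + P.T (lam₂ + P.ρ • P.res U₂ V₂) V₂‖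
      ≤ (2 * P.L * P.δ ^ 2 + P.Lf + P.γ + 3 * P.s * P.M
        + 2 * P.s * P.δ * (e + P.ρ * P.s * P.δ)) * d := by
    have e1 : P.G V₂ U₂ + P.γ • (U₂ - V₂) + P.T (lam₂ + P.ρ • P.res U₂ V₂) V₂
        = (P.G V₂ U₂ - P.G V₁ U₂) + P.γ • (V₁ - V₂)
          + P.T (lam₂ + (lam₂ - lam₁)) (V₂ - V₁)
          + P.T ((lam₂ - lam₁) + P.ρ • P.B U₂ (V₂ - V₁)) V₁ := by
      have hT : P.ρ • P.T (P.res U₂ V₂) V₁ = P.T lam₂ V₁ - P.T lam₁ V₁ := by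
        rw [← LinearMap.smul_apply, ← map_smul, ← hres, map_sub, LinearMap.sub_apply]
      refine (sub_zero _).symm.trans ?_
      rw [← sU, ← P.res_sub, ← hres]
      simp only [map_add, map_sub, map_smul, smul_sub, LinearMap.add_apply, LinearMap.sub_apply,
        LinearMap.smul_apply, hT]
      module
    have t1 := P.G_lip V₁ U₂ V₂ U₂ (by rw [mul_comm]; exact g21.mul_le)
      (by rw [mul_comm]; exact h2.good.mul_le)
    rw [sub_self, norm_zero, mul_zero, zero_add] at t1
    have t1' : ‖P.G V₂ U₂ - P.G V₁ U₂‖ ≤ P.L * (2 * P.δ) * (P.δ * d) + P.Lf * d :=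
      t1.trans (by gcongr)
    have t2 : ‖P.γ • (V₁ - V₂)‖ ≤ P.γ * d := by
      rw [norm_smul, Real.norm_eq_abs, abs_of_pos hγ, norm_sub_rev]
      gcongr
    have m1 : ‖lam₂ + (lam₂ - lam₁)‖ ≤ 3 * P.M := by
      have := P.mult_le h1.good h1.stat
      have := P.mult_le h2.good h2.stat
      linarith [norm_add_le lam₂ (lam₂ - lam₁), norm_sub_le lam₂ lam₁]
    have t3 : ‖P.T (lam₂ + (lam₂ - lam₁)) (V₂ - V₁)‖ ≤ P.s * (3 * P.M) * d :=
      (P.T_le _ _).trans (by gcongr)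
    have m2 : ‖(lam₂ - lam₁) + P.ρ • P.B U₂ (V₂ - V₁)‖ ≤ e * d + P.ρ * (P.s * P.δ * d) := by
      refine (norm_add_le _ _).trans (add_le_add hΔ ?_)
      rw [norm_smul, Real.norm_eq_abs, abs_of_pos hρ]
      refine mul_le_mul_of_nonneg_left ((P.norm_B_le _ _).trans ?_) hρ.le
      gcongr
    have t4 : ‖P.T ((lam₂ - lam₁) + P.ρ • P.B U₂ (V₂ - V₁)) V₁‖
        ≤ P.s * (e * d + P.ρ * (P.s * P.δ * d)) * (2 * P.δ) :=
      (P.T_le _ _).trans (by gcongr)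
    rw [e1]
    have t12 := norm_add₃_le (a := P.G V₂ U₂ - P.G V₁ U₂) (b := P.γ • (V₁ - V₂))
      (c := P.T (lam₂ + (lam₂ - lam₁)) (V₂ - V₁))
    refine (norm_add_le _ _).trans ?_
    linarith
  unfold gradSum gradConst
  linarith

/-- Sublinear convergence of the alternating direction method of multipliers. -/
theorem exists_dist_le [Nontrivial H] [ProperSpace E] [ProperSpace H] {U V : ℕ → E} {lam : ℕ → H}
    (hstep : ∀ k, P.Step (U k) (V k) (lam k) (U (k + 1)) (V (k + 1)) (lam (k + 1)))
    (hinit : P.lag (U 0) (V 0) (lam 0) + 1 / P.ρ * ‖lam 0‖ ^ 2 ≤ P.β₀)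
    {α : ℝ} (h0 : 1 / 2 < α) (h1 : α < 1) {c ε : ℝ} (hc : 0 < c) (hε : 0 < ε)
    (hKL : ∀ x y : E × E × H, P.gradSum y = 0 → dist x y ≤ ε →
      |P.lag x.1 x.2.1 x.2.2 - P.lag y.1 y.2.1 y.2.2| ^ α ≤ c * P.gradSum x) :
    ∃ (k₀ : ℕ) (ξ : ℝ), 0 < ξ ∧ ∀ k : ℕ, k₀ < k → ∃ y, P.gradSum y = 0 ∧
      dist (U k, V k, lam k) y ≤ ξ * ((k : ℝ) - k₀) ^ (-(1 - α) / (2 * α - 1)) := by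
  have hν := P.ν_pos
  have hη := P.η_pos
  have hp := P.p_pos
  have hinv : ∀ k, P.Inv (U (k + 2)) (V (k + 2)) (lam (k + 2)) := by
    intro k
    induction k with
    | zero => exact (hstep 0).inv_second (hstep 1) hinit
    | succ k ih => exact (ih.next (hstep (k + 2))).1
  set z : ℕ → E × E × H := fun k => (U (k + 2), V (k + 2), lam (k + 2))
  set d : ℕ → ℝ := fun k => ‖U (k + 3) - U (k + 2)‖ + ‖V (k + 3) - V (k + 2)‖ with hd
  have hd0 : ∀ k, 0 ≤ d k := fun k => by positivity
  set C := max (max (1 + P.p / P.η) (2 / P.ν)) P.gradConst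
  have hC1 : 1 + P.p / P.η ≤ C := (le_max_left _ _).trans (le_max_left _ _)
  have hC2 : 2 / P.ν ≤ C := (le_max_right _ _).trans (le_max_left _ _)
  have hC3 : P.gradConst ≤ C := le_max_right _ _
  have hC : 0 < C := lt_of_lt_of_le (by positivity) hC1
  have hK : IsCompact (Metric.closedBall (0 : E) (2 * P.δ) ×ˢ Metric.closedBall (0 : E) (2 * P.δ)
      ×ˢ Metric.closedBall (0 : H) P.M) :=
    (isCompact_closedBall _ _).prod ((isCompact_closedBall _ _).prod (isCompact_closedBall _ _))
  obtain ⟨k₀, ξ, hξ, h⟩ := exists_dist_zero_le P.lag_cont P.gradSum_cont P.gradSum_nonneg hK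
    (z := z) (d := d) (fun k => by
      have g := (hinv k).good.add_le
      simp only [z, Set.mem_prod, mem_closedBall_zero_iff]
      exact ⟨by linarith [norm_nonneg (V (k + 2))], by linarith [norm_nonneg (U (k + 2))],
        P.mult_le (hinv k).good (hinv k).stat⟩)
    hd0 hC (fun k => by
      have hs := hstep (k + 2)
      have hch := hs.mult_change (hinv k).good ((hinv k).next hs).2.1 (hinv (k + 1)).good
        (hinv k).stat
      have hle : ‖lam (k + 3) - lam (k + 2)‖ ≤ P.p / P.η * d k := by
        rw [div_mul_eq_mul_div, le_div_iff₀ hη, mul_comm]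
        exact hch
      have hpd : 0 ≤ P.p / P.η * d k := mul_nonneg (by positivity) (hd0 k)
      refine le_trans ?_ (mul_le_mul_of_nonneg_right hC1 (hd0 k))
      rw [dist_comm, Prod.dist_eq, Prod.dist_eq, dist_eq_norm, dist_eq_norm, dist_eq_norm]
      have hu := norm_nonneg (U (k + 3) - U (k + 2))
      have hv := norm_nonneg (V (k + 3) - V (k + 2))
      have hdk : d k = ‖U (k + 3) - U (k + 2)‖ + ‖V (k + 3) - V (k + 2)‖ := rfl
      refine max_le ?_ (max_le ?_ ?_)
      · change ‖U (k + 3) - U (k + 2)‖ ≤ _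
        linarith
      · change ‖V (k + 3) - V (k + 2)‖ ≤ _
        linarith
      · change ‖lam (k + 3) - lam (k + 2)‖ ≤ _
        linarith)
    (fun k => by
      have hs := ((hinv k).next (hstep (k + 2))).2.2
      have hdiff : P.ν * (‖U (k + 3) - U (k + 2)‖ ^ 2 + ‖V (k + 3) - V (k + 2)‖ ^ 2)
          ≤ P.lag (z k).1 (z k).2.1 (z k).2.2
            - P.lag (z (k + 1)).1 (z (k + 1)).2.1 (z (k + 1)).2.2 := by
        simp only [z]
        linarith
      have hnn := le_trans (by positivity) hdiff
      refine le_trans ?_ (mul_le_mul_of_nonneg_right hC2 hnn)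
      rw [div_mul_eq_mul_div, le_div_iff₀ hν]
      have : d k ^ 2 ≤ 2 * (‖U (k + 3) - U (k + 2)‖ ^ 2 + ‖V (k + 3) - V (k + 2)‖ ^ 2) := add_sq_le
      nlinarith)
    (fun k => ((hstep (k + 2)).gradSum_le (hinv k) ((hinv k).next (hstep (k + 2))).2.1
      (hinv (k + 1))).trans (mul_le_mul_of_nonneg_right hC3 (hd0 k)))
    h0 h1 hc hε hKL
  refine ⟨k₀ + 2, ξ, hξ, fun k hk => ?_⟩
  obtain ⟨j, rfl⟩ : ∃ j, k = j + 2 := ⟨k - 2, by omega⟩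
  obtain ⟨y, hy, hle⟩ := h j (by omega)
  refine ⟨y, hy, ?_⟩
  convert hle using 3
  push_cast
  ring

end BilinearProblem

section Matrix

variable {ι κ τ : Type*}

/-- Euclidean vectors indexed by pairs, viewed as matrices. -/
def euclMat (ι κ : Type*) : EuclideanSpace ℝ (ι × κ) ≃ₗ[ℝ] Matrix ι κ ℝ where
  toFun x := Matrix.of fun i j => x (i, j)
  invFun M := WithLp.toLp 2 fun p => M p.1 p.2
  map_add' _ _ := rfl
  map_smul' _ _ := rfl
  left_inv _ := rfl
  right_inv _ := rfl

lemma euclMat_apply (x : EuclideanSpace ℝ (ι × κ)) (i : ι) (j : κ) : euclMat ι κ x i j = x (i, j) :=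
  rfl

lemma continuous_euclMat : Continuous (euclMat ι κ) :=
  continuous_matrix fun i j => by simp only [euclMat_apply]; fun_prop

lemma continuous_euclMat_symm : Continuous (euclMat ι κ).symm := by
  refine (PiLp.continuous_toLp 2 _).comp (continuous_pi fun p => ?_)
  exact (continuous_apply p.2).comp (continuous_apply p.1)

variable [Fintype ι] [Fintype κ] [Fintype τ]

lemma frobInner_euclMat (x y : EuclideanSpace ℝ (ι × κ)) :
    frobInner (euclMat ι κ x) (euclMat ι κ y) = inner ℝ x y := by
  rw [PiLp.inner_apply, Fintype.sum_prod_type]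
  simp only [frobInner, euclMat_apply, RCLike.inner_apply, conj_trivial, mul_comm]

lemma frobNorm_euclMat (x : EuclideanSpace ℝ (ι × κ)) : frobNorm (euclMat ι κ x) = ‖x‖ := by
  rw [EuclideanSpace.norm_eq, Fintype.sum_prod_type]
  simp only [frobNorm, euclMat_apply, Real.norm_eq_abs, sq_abs]

lemma norm_euclMat_symm (M : Matrix ι κ ℝ) : ‖(euclMat ι κ).symm M‖ = frobNorm M := by
  rw [← frobNorm_euclMat, LinearEquiv.apply_symm_apply]

lemma vecNorm_ofLp (x : EuclideanSpace ℝ ι) : vecNorm x.ofLp = ‖x‖ := by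
  rw [EuclideanSpace.norm_eq]
  simp only [vecNorm, Real.norm_eq_abs, sq_abs]

lemma vecNorm_nonneg (v : ι → ℝ) : 0 ≤ vecNorm v := Real.sqrt_nonneg _

lemma vecNorm_smul (c : ℝ) (v : ι → ℝ) : vecNorm (c • v) = |c| * vecNorm v := by
  have := norm_smul c (WithLp.toLp 2 v)
  rwa [← vecNorm_ofLp, ← vecNorm_ofLp] at this

lemma frobNorm_nonneg (M : Matrix ι κ ℝ) : 0 ≤ frobNorm M := Real.sqrt_nonneg _

lemma frobNorm_add_le (X Y : Matrix ι κ ℝ) : frobNorm (X + Y) ≤ frobNorm X + frobNorm Y := by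
  simp only [← norm_euclMat_symm, map_add]
  exact norm_add_le _ _

lemma frobNorm_transpose (X : Matrix ι κ ℝ) : frobNorm Xᵀ = frobNorm X := by
  simp only [frobNorm, Matrix.transpose_apply]
  rw [Finset.sum_comm]

lemma frobNorm_mul_le (X : Matrix ι κ ℝ) (Y : Matrix κ τ ℝ) :
    frobNorm (X * Y) ≤ frobNorm X * frobNorm Y := by
  rw [frobNorm, frobNorm, frobNorm, ← Real.sqrt_mul (by positivity)]
  refine Real.sqrt_le_sqrt ?_
  rw [Finset.sum_comm (f := fun k j => Y k j ^ 2), Finset.sum_mul_sum]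
  exact Finset.sum_le_sum fun i _ => Finset.sum_le_sum fun j _ =>
    Finset.sum_mul_sq_le_sq_mul_sq _ _ _

lemma frobInner_comm (X Y : Matrix ι κ ℝ) : frobInner X Y = frobInner Y X := by
  simp only [frobInner, mul_comm]

lemma frobInner_eq_trace (X Y : Matrix ι κ ℝ) : frobInner X Y = (X * Yᵀ).trace := rfl

lemma frobInner_add_right (X Y Z : Matrix ι κ ℝ) :
    frobInner X (Y + Z) = frobInner X Y + frobInner X Z := by
  simp [frobInner_eq_trace, Matrix.mul_add]

lemma frobInner_smul_right (c : ℝ) (X Y : Matrix ι κ ℝ) :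
    frobInner X (c • Y) = c * frobInner X Y := by
  simp [frobInner_eq_trace]

lemma frobInner_transpose_right (X : Matrix ι κ ℝ) (Y : Matrix κ ι ℝ) :
    frobInner X Yᵀ = frobInner Xᵀ Y := by
  simp only [frobInner, Matrix.transpose_apply]
  exact Finset.sum_comm

/-- Multiplication on the right is adjoint to multiplication by the transpose. -/
lemma frobInner_mul_left (X : Matrix ι τ ℝ) (U : Matrix τ κ ℝ) (V : Matrix ι κ ℝ) :
    frobInner (X * U) V = frobInner X (V * Uᵀ) := by
  rw [frobInner_eq_trace, frobInner_eq_trace, transpose_mul, transpose_transpose, Matrix.mul_assoc]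

lemma eq_of_frobInner_eq {X Y : Matrix ι κ ℝ} (h : ∀ Z, frobInner X Z = frobInner Y Z) : X = Y := by
  refine (euclMat ι κ).symm.injective (ext_inner_right ℝ fun z => ?_)
  simpa only [← frobInner_euclMat, LinearEquiv.apply_symm_apply] using h (euclMat ι κ z)

lemma transpose_gradient {f : Matrix ι ι ℝ → ℝ} {grad : Matrix ι ι ℝ → Matrix ι ι ℝ}
    (hsym : ∀ X, f Xᵀ = f X)
    (hgrad : ∀ X Z, HasDerivAt (fun t : ℝ => f (X + t • Z)) (frobInner (grad X) Z) 0)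
    (X : Matrix ι ι ℝ) : (grad X)ᵀ = grad Xᵀ := by
  refine eq_of_frobInner_eq fun Z => ?_
  rw [← frobInner_transpose_right]
  refine (hgrad X Zᵀ).unique ?_
  refine (hgrad Xᵀ Z).congr_of_eventuallyEq (Filter.Eventually.of_forall fun t => ?_)
  change f (X + t • Zᵀ) = f (Xᵀ + t • Z)
  rw [← hsym, transpose_add, transpose_smul, transpose_transpose]

lemma continuous_of_convexOn_matrix {f : Matrix ι κ ℝ → ℝ} (hf : ConvexOn ℝ Set.univ f) :
    Continuous f := by
  have h : ConvexOn ℝ Set.univ (f ∘ euclMat ι κ) := by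
    simpa using hf.comp_linearMap (euclMat ι κ).toLinearMap
  have h2 : Continuous (f ∘ euclMat ι κ) :=
    continuousOn_univ.1 (by simpa using h.continuousOn_interior)
  convert h2.comp continuous_euclMat_symm
  ext M
  simp

lemma mul_vecNorm_le_of_le_sigmaMin {M : Matrix ι κ ℝ} {η : ℝ} (h : η ≤ sigmaMin M) (x : κ → ℝ) :
    η * vecNorm x ≤ vecNorm (M.mulVec x) := by
  rcases (vecNorm_nonneg x).eq_or_lt with h0 | h0
  · rw [← h0, mul_zero]
    exact vecNorm_nonneg _
  · have h1 : sigmaMin M ≤ vecNorm (M.mulVec ((vecNorm x)⁻¹ • x)) :=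
      csInf_le ⟨0, by rintro _ ⟨y, -, rfl⟩; exact vecNorm_nonneg _⟩
        ⟨_, by rw [vecNorm_smul, abs_of_pos (by positivity), inv_mul_cancel₀ h0.ne'], rfl⟩
    rw [Matrix.mulVec_smul, vecNorm_smul, abs_of_pos (by positivity), inv_mul_eq_div] at h1
    exact (le_div_iff₀ h0).1 (h.trans h1)

end Matrix

section Problem

variable {n m r : ℕ} (A : Fin m → Matrix (Fin n) (Fin n) ℝ)

/-- The bilinear map `(U, V) ↦ 𝒜(U Vᵀ)`. -/
def constraintForm (r : ℕ) : EuclideanSpace ℝ (Fin n × Fin r) →ₗ[ℝ]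
    EuclideanSpace ℝ (Fin n × Fin r) →ₗ[ℝ] EuclideanSpace ℝ (Fin m) :=
  LinearMap.mk₂ ℝ
    (fun x y => WithLp.toLp 2 (Aop A (euclMat (Fin n) (Fin r) x * (euclMat (Fin n) (Fin r) y)ᵀ)))
    (fun x x' y => by ext i; simp [Aop, Matrix.add_mul, frobInner_add_right])
    (fun c x y => by ext i; simp [Aop, frobInner_smul_right])
    (fun x y y' => by ext i; simp [Aop, Matrix.mul_add, frobInner_add_right])
    (fun c x y => by ext i; simp [Aop, frobInner_smul_right])

/-- The bilinear map `(μ, U) ↦ ∑ i, μ i • A i U`. -/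
def multiplierForm (r : ℕ) : EuclideanSpace ℝ (Fin m) →ₗ[ℝ]
    EuclideanSpace ℝ (Fin n × Fin r) →ₗ[ℝ] EuclideanSpace ℝ (Fin n × Fin r) :=
  LinearMap.mk₂ ℝ
    (fun μ x => (euclMat (Fin n) (Fin r)).symm (∑ i, μ i • (A i * euclMat (Fin n) (Fin r) x)))
    (fun μ μ' x => by simp [add_smul, Finset.sum_add_distrib])
    (fun c μ x => by simp [mul_smul, Finset.smul_sum])
    (fun μ x x' => by simp [Matrix.mul_add, Finset.sum_add_distrib])
    (fun c μ x => by simp [Finset.smul_sum, smul_comm c])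

variable {A}

lemma constraintForm_apply (x y : EuclideanSpace ℝ (Fin n × Fin r)) (i : Fin m) :
    constraintForm A r x y i
      = frobInner (A i) (euclMat (Fin n) (Fin r) x * (euclMat (Fin n) (Fin r) y)ᵀ) := rfl

lemma euclMat_multiplierForm (μ : EuclideanSpace ℝ (Fin m))
    (x : EuclideanSpace ℝ (Fin n × Fin r)) :
    euclMat (Fin n) (Fin r) (multiplierForm A r μ x)
      = ∑ i, μ i • (A i * euclMat (Fin n) (Fin r) x) := rfl

lemma continuous_mul_transpose :
    Continuous fun p : EuclideanSpace ℝ (Fin n × Fin r) × EuclideanSpace ℝ (Fin n × Fin r) =>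
      euclMat (Fin n) (Fin r) p.1 * (euclMat (Fin n) (Fin r) p.2)ᵀ :=
  (continuous_euclMat.comp continuous_fst).matrix_mul
    (continuous_euclMat.comp continuous_snd).matrix_transpose

lemma continuous_frobInner (X : Matrix (Fin n) (Fin r) ℝ) : Continuous (frobInner X) := by
  unfold frobInner
  fun_prop

lemma continuous_constraintForm :
    Continuous fun p : EuclideanSpace ℝ (Fin n × Fin r) × EuclideanSpace ℝ (Fin n × Fin r) =>
      constraintForm A r p.1 p.2 :=
  (PiLp.continuous_toLp 2 _).comp
    (continuous_pi fun i => (continuous_frobInner (A i)).comp continuous_mul_transpose)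

lemma continuous_multiplierForm :
    Continuous fun p : EuclideanSpace ℝ (Fin m) × EuclideanSpace ℝ (Fin n × Fin r) =>
      multiplierForm A r p.1 p.2 := by
  refine continuous_euclMat_symm.comp (continuous_finsetSum _ fun i _ => ?_)
  have hμ : Continuous fun p : EuclideanSpace ℝ (Fin m) × EuclideanSpace ℝ (Fin n × Fin r) =>
      p.1 i := by fun_prop
  exact hμ.smul (continuous_const.matrix_mul (continuous_euclMat.comp continuous_snd))

lemma constraintForm_symm (hA : ∀ i, (A i)ᵀ = A i) (x y : EuclideanSpace ℝ (Fin n × Fin r)) :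
    constraintForm A r x y = constraintForm A r y x := by
  ext i
  rw [constraintForm_apply, constraintForm_apply, ← transpose_transpose (euclMat _ _ x * _),
    frobInner_transpose_right, hA, transpose_mul, transpose_transpose]

lemma inner_multiplierForm (hA : ∀ i, (A i)ᵀ = A i) (μ : EuclideanSpace ℝ (Fin m))
    (x y : EuclideanSpace ℝ (Fin n × Fin r)) :
    inner ℝ (multiplierForm A r μ x) y = inner ℝ μ (constraintForm A r x y) := by
  rw [constraintForm_symm hA, real_inner_comm, ← frobInner_euclMat, euclMat_multiplierForm,
    PiLp.inner_apply]
  have h : ∀ s : Finset (Fin m), frobInner (euclMat (Fin n) (Fin r) y)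
      (∑ i ∈ s, μ i • (A i * euclMat (Fin n) (Fin r) x))
      = ∑ i ∈ s, inner ℝ (μ i) (constraintForm A r y x i) := by
    intro s
    induction s using Finset.induction_on with
    | empty => simp [frobInner]
    | insert i s hi ih =>
      rw [Finset.sum_insert hi, Finset.sum_insert hi, frobInner_add_right, ih, frobInner_smul_right]
      congr 1
      rw [constraintForm_apply, frobInner_comm, frobInner_mul_left]
      simp [mul_comm]
  exact h _

lemma norm_multiplierForm_le (μ : EuclideanSpace ℝ (Fin m))
    (x : EuclideanSpace ℝ (Fin n × Fin r)) :
    ‖multiplierForm A r μ x‖ ≤ √(sA A) * ‖μ‖ * ‖x‖ := by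
  change ‖(euclMat (Fin n) (Fin r)).symm (∑ i, μ i • (A i * euclMat (Fin n) (Fin r) x))‖ ≤ _
  rw [map_sum]
  have h1 : ∀ i, ‖(euclMat (Fin n) (Fin r)).symm (μ i • (A i * euclMat (Fin n) (Fin r) x))‖
      ≤ frobNorm (A i) * |μ i| * ‖x‖ := by
    intro i
    rw [map_smul, norm_smul, norm_euclMat_symm, Real.norm_eq_abs]
    have := mul_le_mul_of_nonneg_left (frobNorm_mul_le (A i) (euclMat (Fin n) (Fin r) x))
      (abs_nonneg (μ i))
    rw [frobNorm_euclMat] at this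
    linarith
  refine (norm_sum_le _ _).trans ((Finset.sum_le_sum fun i _ => h1 i).trans ?_)
  rw [← Finset.sum_mul]
  refine mul_le_mul_of_nonneg_right ?_ (norm_nonneg x)
  have := Real.sum_mul_le_sqrt_mul_sqrt Finset.univ (fun i => frobNorm (A i)) (fun i => |μ i|)
  simpa only [EuclideanSpace.norm_eq, Real.norm_eq_abs, sA] using this

lemma mul_norm_le_norm_multiplierForm {η : ℝ} {x : EuclideanSpace ℝ (Fin n × Fin r)}
    (h : η ≤ sigmaMin (Cmat A (euclMat (Fin n) (Fin r) x))) (μ : EuclideanSpace ℝ (Fin m)) :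
    η * ‖μ‖ ≤ ‖multiplierForm A r μ x‖ := by
  have := mul_vecNorm_le_of_le_sigmaMin h μ.ofLp
  rw [vecNorm_ofLp] at this
  refine this.trans (le_of_eq ?_)
  rw [← vecNorm_ofLp]
  congr 1
  ext p
  change _ = euclMat (Fin n) (Fin r) (multiplierForm A r μ x) p.1 p.2
  rw [euclMat_multiplierForm, Matrix.sum_apply]
  simp [Matrix.mulVec, dotProduct, Cmat, mul_comm]

lemma vecNorm_residual (b : Fin m → ℝ) (x y : EuclideanSpace ℝ (Fin n × Fin r)) :
    vecNorm (fun i => Aop A (euclMat (Fin n) (Fin r) x * (euclMat (Fin n) (Fin r) y)ᵀ) i - b i)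
      = ‖constraintForm A r x y - WithLp.toLp 2 b‖ :=
  vecNorm_ofLp (constraintForm A r x y - WithLp.toLp 2 b)

lemma mem_Sset_euclMat {f : Matrix (Fin n) (Fin n) ℝ → ℝ} {b : Fin m → ℝ} {ρ₀ β : ℝ}
    {x y : EuclideanSpace ℝ (Fin n × Fin r)} :
    (euclMat (Fin n) (Fin r) x, euclMat (Fin n) (Fin r) y) ∈ Sset f A b ρ₀ β ↔
      f (euclMat (Fin n) (Fin r) x * (euclMat (Fin n) (Fin r) y)ᵀ) + ρ₀ / 2 * ‖x - y‖ ^ 2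
        + ρ₀ / 2 * ‖constraintForm A r x y - WithLp.toLp 2 b‖ ^ 2 ≤ β := by
  rw [← vecNorm_residual, ← frobNorm_euclMat, map_sub]
  rfl

lemma isCompact_euclMat_Sset {f : Matrix (Fin n) (Fin n) ℝ → ℝ} {b : Fin m → ℝ} {ρ₀ β : ℝ}
    (h : IsCompact (Sset (r := r) f A b ρ₀ β) ∨ Sset (r := r) f A b ρ₀ β = ∅) :
    IsCompact {p : EuclideanSpace ℝ (Fin n × Fin r) × EuclideanSpace ℝ (Fin n × Fin r) |
      f (euclMat (Fin n) (Fin r) p.1 * (euclMat (Fin n) (Fin r) p.2)ᵀ) + ρ₀ / 2 * ‖p.1 - p.2‖ ^ 2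
        + ρ₀ / 2 * ‖constraintForm A r p.1 p.2 - WithLp.toLp 2 b‖ ^ 2 ≤ β} := by
  have hS : IsCompact (Sset (r := r) f A b ρ₀ β) := h.elim id fun h => h ▸ isCompact_empty
  convert hS.image ((continuous_euclMat_symm (ι := Fin n) (κ := Fin r)).prodMap
    (continuous_euclMat_symm (ι := Fin n) (κ := Fin r))) using 1
  ext ⟨x, y⟩
  rw [Set.mem_ofPred_eq, ← mem_Sset_euclMat]
  constructor
  · exact fun h => ⟨_, h, by simp⟩
  · rintro ⟨⟨X, Y⟩, h, he⟩
    obtain ⟨rfl, rfl⟩ := Prod.mk.inj he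
    simpa using h

/-- The gradient of `V ↦ f (U Vᵀ)`, in Euclidean coordinates. -/
def blockGradient (grad : Matrix (Fin n) (Fin n) ℝ → Matrix (Fin n) (Fin n) ℝ)
    (x y : EuclideanSpace ℝ (Fin n × Fin r)) : EuclideanSpace ℝ (Fin n × Fin r) :=
  (euclMat (Fin n) (Fin r)).symm
    (grad (euclMat (Fin n) (Fin r) y * (euclMat (Fin n) (Fin r) x)ᵀ) * euclMat (Fin n) (Fin r) x)

variable {f : Matrix (Fin n) (Fin n) ℝ → ℝ}
  {grad : Matrix (Fin n) (Fin n) ℝ → Matrix (Fin n) (Fin n) ℝ}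

lemma euclMat_blockGradient (x y : EuclideanSpace ℝ (Fin n × Fin r)) :
    euclMat (Fin n) (Fin r) (blockGradient grad x y)
      = grad (euclMat (Fin n) (Fin r) y * (euclMat (Fin n) (Fin r) x)ᵀ)
        * euclMat (Fin n) (Fin r) x :=
  rfl

lemma hasDerivAt_blockGradient (hsym : ∀ X, f Xᵀ = f X)
    (hgrad : ∀ X Z, HasDerivAt (fun t : ℝ => f (X + t • Z)) (frobInner (grad X) Z) 0)
    (x y z : EuclideanSpace ℝ (Fin n × Fin r)) :
    HasDerivAt (fun t : ℝ => f (euclMat (Fin n) (Fin r) x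
      * (euclMat (Fin n) (Fin r) (y + t • z))ᵀ)) (inner ℝ (blockGradient grad x y) z) 0 := by
  convert hgrad (euclMat (Fin n) (Fin r) x * (euclMat (Fin n) (Fin r) y)ᵀ)
    (euclMat (Fin n) (Fin r) x * (euclMat (Fin n) (Fin r) z)ᵀ) using 1
  · ext t
    simp [Matrix.mul_add]
  · rw [← frobInner_euclMat, euclMat_blockGradient, frobInner_mul_left,
      ← transpose_transpose (euclMat (Fin n) (Fin r) x * (euclMat (Fin n) (Fin r) z)ᵀ),
      frobInner_transpose_right, transpose_gradient hsym hgrad]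
    simp

lemma continuous_blockGradient (hgrad : Continuous grad) :
    Continuous fun p : EuclideanSpace ℝ (Fin n × Fin r) × EuclideanSpace ℝ (Fin n × Fin r) =>
      blockGradient grad p.1 p.2 :=
  continuous_euclMat_symm.comp
    ((hgrad.comp (continuous_mul_transpose.comp continuous_swap)).matrix_mul
      (continuous_euclMat.comp continuous_fst))

lemma frobNorm_mul_transpose_le (x y : EuclideanSpace ℝ (Fin n × Fin r)) :
    frobNorm (euclMat (Fin n) (Fin r) x * (euclMat (Fin n) (Fin r) y)ᵀ) ≤ ‖x‖ * ‖y‖ := by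
  simpa only [frobNorm_transpose, frobNorm_euclMat] using
    frobNorm_mul_le (euclMat (Fin n) (Fin r) x) (euclMat (Fin n) (Fin r) y)ᵀ

lemma norm_blockGradient_le {R K : ℝ}
    (hK : ∀ X, frobNorm X ≤ R → frobNorm (grad X) ≤ K) {x y : EuclideanSpace ℝ (Fin n × Fin r)}
    (h : ‖x‖ * ‖y‖ ≤ R) : ‖blockGradient grad x y‖ ≤ K * ‖x‖ := by
  rw [← frobNorm_euclMat, euclMat_blockGradient, ← frobNorm_euclMat x]
  refine (frobNorm_mul_le _ _).trans (mul_le_mul_of_nonneg_right (hK _ ?_) (frobNorm_nonneg _))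
  rw [mul_comm] at h
  exact (frobNorm_mul_transpose_le y x).trans h

lemma norm_blockGradient_sub_le {R K K' : ℝ} (hK'_nonneg : 0 ≤ K')
    (hK : ∀ X, frobNorm X ≤ R → frobNorm (grad X) ≤ K)
    (hK' : ∀ X Y, frobNorm X ≤ R → frobNorm Y ≤ R →
      frobNorm (grad X - grad Y) ≤ K' * frobNorm (X - Y))
    {x y x' y' : EuclideanSpace ℝ (Fin n × Fin r)}
    (h : ‖x‖ * ‖y‖ ≤ R) (h' : ‖x'‖ * ‖y'‖ ≤ R) :
    ‖blockGradient grad x' y' - blockGradient grad x y‖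
      ≤ K' * ‖x'‖ * (‖x'‖ * ‖y' - y‖ + ‖y‖ * ‖x' - x‖) + K * ‖x' - x‖ := by
  set X := euclMat (Fin n) (Fin r) x with hX
  set X' := euclMat (Fin n) (Fin r) x' with hX'
  set Y := euclMat (Fin n) (Fin r) y with hY
  set Y' := euclMat (Fin n) (Fin r) y' with hY'
  rw [mul_comm] at h h'
  have hb := (frobNorm_mul_transpose_le y x).trans h
  have hb' := (frobNorm_mul_transpose_le y' x').trans h'
  have e : euclMat (Fin n) (Fin r) (blockGradient grad x' y' - blockGradient grad x y)
      = (grad (Y' * X'ᵀ) - grad (Y * Xᵀ)) * X' + grad (Y * Xᵀ) * (X' - X) := by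
    rw [map_sub, euclMat_blockGradient, euclMat_blockGradient, Matrix.sub_mul, Matrix.mul_sub]
    abel
  have e2 : Y' * X'ᵀ - Y * Xᵀ = euclMat (Fin n) (Fin r) (y' - y) * X'ᵀ
      + Y * (euclMat (Fin n) (Fin r) (x' - x))ᵀ := by
    rw [map_sub, map_sub, transpose_sub, Matrix.sub_mul, Matrix.mul_sub]
    abel
  have h1 : frobNorm (Y' * X'ᵀ - Y * Xᵀ) ≤ ‖x'‖ * ‖y' - y‖ + ‖y‖ * ‖x' - x‖ := by
    rw [e2]
    refine (frobNorm_add_le _ _).trans (add_le_add ?_ (frobNorm_mul_transpose_le _ _))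
    rw [mul_comm ‖x'‖]
    exact frobNorm_mul_transpose_le _ _
  rw [← frobNorm_euclMat, e]
  refine (frobNorm_add_le _ _).trans (add_le_add ?_ ?_)
  · refine (frobNorm_mul_le _ _).trans ?_
    rw [hX', frobNorm_euclMat, mul_right_comm]
    exact mul_le_mul_of_nonneg_right
      ((hK' _ _ hb' hb).trans (mul_le_mul_of_nonneg_left h1 hK'_nonneg)) (norm_nonneg _)
  · refine (frobNorm_mul_le _ _).trans ?_
    rw [hX', hX, ← map_sub, frobNorm_euclMat]
    exact mul_le_mul_of_nonneg_right (hK _ hb) (norm_nonneg _)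

lemma convexOn_comp_mul_transpose (hf : ConvexOn ℝ Set.univ f)
    (x : EuclideanSpace ℝ (Fin n × Fin r)) :
    ConvexOn ℝ Set.univ fun y : EuclideanSpace ℝ (Fin n × Fin r) =>
      f (euclMat (Fin n) (Fin r) x * (euclMat (Fin n) (Fin r) y)ᵀ) := by
  have h : IsLinearMap ℝ fun y : EuclideanSpace ℝ (Fin n × Fin r) =>
      euclMat (Fin n) (Fin r) x * (euclMat (Fin n) (Fin r) y)ᵀ :=
    ⟨fun y z => by simp [Matrix.mul_add], fun c y => by simp⟩
  exact hf.comp_linearMap h.mk'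

/-- The factorized semidefinite program as a problem with a bilinear constraint. -/
def matrixProblem (hconv : ConvexOn ℝ Set.univ f) (hsym : ∀ X, f Xᵀ = f X)
    (hgrad : ∀ X Z, HasDerivAt (fun t : ℝ => f (X + t • Z)) (frobInner (grad X) Z) 0)
    (hgradCont : Continuous grad) (hA : ∀ i, (A i)ᵀ = A i) (b : Fin m → ℝ)
    {ρ γ ρ₀ δ Lf L η β₀ β : ℝ} (hρ : 0 < ρ) (hγ : 0 < γ) (hρ₀ : 0 < ρ₀) (hδ : 0 < δ)
    (hLf : 0 < Lf) (hL : 0 < L) (hη : 0 < η) (hργ : ρ₀ < γ) (hρ₀ρ : 2 * ρ₀ < ρ)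
    (hlevel : ∀ c, IsCompact (Sset (r := r) f A b ρ₀ c) ∨ Sset (r := r) f A b ρ₀ c = ∅)
    (hδB : ∀ p ∈ Sset (r := r) f A b ρ₀ β, frobNorm p.1 ≤ δ ∧ frobNorm p.2 ≤ δ)
    (hgradB : ∀ X, frobNorm X ≤ δ ^ 2 → frobNorm (grad X) ≤ Lf)
    (hgradLip : ∀ X Y, frobNorm X ≤ δ ^ 2 → frobNorm Y ≤ δ ^ 2 →
      frobNorm (grad X - grad Y) ≤ L * frobNorm (X - Y))
    (hηB : ∀ p ∈ Sset (r := r) f A b ρ₀ β, η ≤ sigmaMin (Cmat A p.1))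
    (hrate : 4 * (L * δ ^ 2 + Lf + γ + √(sA A) * ((Lf + 2 * γ) * δ / η)) ^ 2 < ρ * γ * η ^ 2)
    (hmult : ((Lf + 2 * γ) * δ / η) ^ 2 / ρ < β - β₀) :
    BilinearProblem (EuclideanSpace ℝ (Fin n × Fin r)) (EuclideanSpace ℝ (Fin m)) where
  φ x y := f (euclMat (Fin n) (Fin r) x * (euclMat (Fin n) (Fin r) y)ᵀ)
  G := blockGradient grad
  B := constraintForm A r
  T := multiplierForm A r
  b := WithLp.toLp 2 b
  ρ := ρ
  γ := γ
  ρ₀ := ρ₀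
  δ := δ
  Lf := Lf
  L := L
  η := η
  s := √(sA A)
  β₀ := β₀
  β := β
  φ_symm x y := by rw [← hsym, transpose_mul, transpose_transpose]
  φ_convex := convexOn_comp_mul_transpose hconv
  φ_cont := (continuous_of_convexOn_matrix hconv).comp continuous_mul_transpose
  φ_scale c x y hc := by simp [smul_smul, hc]
  φ_deriv := hasDerivAt_blockGradient hsym hgrad
  G_cont := continuous_blockGradient hgradCont
  B_symm := constraintForm_symm hA
  B_cont := continuous_constraintForm
  T_cont := continuous_multiplierForm
  T_adj := inner_multiplierForm hA
  T_le := norm_multiplierForm_le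
  ρ_pos := hρ
  γ_pos := hγ
  ρ₀_pos := hρ₀
  δ_pos := hδ
  Lf_pos := hLf
  L_pos := hL
  η_pos := hη
  s_nonneg := Real.sqrt_nonneg _
  ρ₀_lt := hργ
  ρ_big := hρ₀ρ
  level_compact c := isCompact_euclMat_Sset (hlevel c)
  level_norm x y h := by simpa only [frobNorm_euclMat] using hδB _ (mem_Sset_euclMat.2 h)
  level_sing x y h μ := mul_norm_le_norm_multiplierForm
    (hηB (euclMat (Fin n) (Fin r) x, euclMat (Fin n) (Fin r) y) (mem_Sset_euclMat.2 h)) μ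
  G_lip _ _ _ _ := norm_blockGradient_sub_le hL.le hgradB hgradLip
  G_le _ _ := norm_blockGradient_le hgradB
  rate_lt := hrate
  mult_lt := hmult

lemma augL_euclMat (f : Matrix (Fin n) (Fin n) ℝ → ℝ) (b : Fin m → ℝ) (ρ γ : ℝ)
    (x y : EuclideanSpace ℝ (Fin n × Fin r)) (θ : EuclideanSpace ℝ (Fin m)) :
    augL f A b ρ γ (euclMat (Fin n) (Fin r) x) (euclMat (Fin n) (Fin r) y) θ.ofLp
      = f (euclMat (Fin n) (Fin r) x * (euclMat (Fin n) (Fin r) y)ᵀ) + γ / 2 * ‖x - y‖ ^ 2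
        + inner ℝ θ (constraintForm A r x y - WithLp.toLp 2 b)
        + ρ / 2 * ‖constraintForm A r x y - WithLp.toLp 2 b‖ ^ 2 := by
  rw [augL, vecNorm_residual, ← map_sub, frobNorm_euclMat, PiLp.inner_apply]
  simp only [RCLike.inner_apply, conj_trivial, mul_comm (θ.ofLp _)]
  rfl

lemma frobNorm_stationarity (grad : Matrix (Fin n) (Fin n) ℝ → Matrix (Fin n) (Fin n) ℝ) (γ : ℝ)
    (x y : EuclideanSpace ℝ (Fin n × Fin r)) (μ : EuclideanSpace ℝ (Fin m)) :
    frobNorm (grad (euclMat (Fin n) (Fin r) x * (euclMat (Fin n) (Fin r) y)ᵀ)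
        * euclMat (Fin n) (Fin r) y + γ • (euclMat (Fin n) (Fin r) x - euclMat (Fin n) (Fin r) y)
        + ∑ i, μ i • (A i * euclMat (Fin n) (Fin r) y))
      = ‖blockGradient grad y x + γ • (x - y) + multiplierForm A r μ y‖ :=
  frobNorm_euclMat (blockGradient grad y x + γ • (x - y) + multiplierForm A r μ y)

lemma gradAugLNorm_euclMat_le (grad : Matrix (Fin n) (Fin n) ℝ → Matrix (Fin n) (Fin n) ℝ)
    (b : Fin m → ℝ) (ρ γ : ℝ) (x y : EuclideanSpace ℝ (Fin n × Fin r))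
    (θ : EuclideanSpace ℝ (Fin m)) :
    gradAugLNorm grad A b ρ γ (euclMat (Fin n) (Fin r) x) (euclMat (Fin n) (Fin r) y) θ.ofLp
      ≤ ‖blockGradient grad y x + γ • (x - y)
          + multiplierForm A r (θ + ρ • (constraintForm A r x y - WithLp.toLp 2 b)) y‖
        + ‖blockGradient grad x y + γ • (y - x)
          + multiplierForm A r (θ + ρ • (constraintForm A r x y - WithLp.toLp 2 b)) x‖
        + ‖constraintForm A r x y - WithLp.toLp 2 b‖ := by
  rw [← frobNorm_stationarity, ← frobNorm_stationarity, ← vecNorm_residual]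
  refine Real.sqrt_le_iff.2 ⟨add_nonneg (add_nonneg (frobNorm_nonneg _) (frobNorm_nonneg _))
    (vecNorm_nonneg _), ?_⟩
  have key : ∀ a b c : ℝ, 0 ≤ a → 0 ≤ b → 0 ≤ c → a ^ 2 + b ^ 2 + c ^ 2 ≤ (a + b + c) ^ 2 := by
    intro a b c ha hb hc
    nlinarith [mul_nonneg ha hb, mul_nonneg ha hc, mul_nonneg hb hc]
  exact key _ _ _ (frobNorm_nonneg _) (frobNorm_nonneg _) (vecNorm_nonneg _)

lemma mem_KKTset_euclMat {grad : Matrix (Fin n) (Fin n) ℝ → Matrix (Fin n) (Fin n) ℝ}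
    {b : Fin m → ℝ} {ρ γ : ℝ} {x y : EuclideanSpace ℝ (Fin n × Fin r)}
    {θ : EuclideanSpace ℝ (Fin m)}
    (h : ‖blockGradient grad y x + γ • (x - y)
          + multiplierForm A r (θ + ρ • (constraintForm A r x y - WithLp.toLp 2 b)) y‖
        + ‖blockGradient grad x y + γ • (y - x)
          + multiplierForm A r (θ + ρ • (constraintForm A r x y - WithLp.toLp 2 b)) x‖
        + ‖constraintForm A r x y - WithLp.toLp 2 b‖ = 0) :
    (euclMat (Fin n) (Fin r) x, euclMat (Fin n) (Fin r) y, θ.ofLp) ∈ KKTset r grad A b γ := by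
  obtain ⟨h12, h3⟩ := (add_eq_zero_iff_of_nonneg (by positivity) (by positivity)).1 h
  obtain ⟨h1, h2⟩ := (add_eq_zero_iff_of_nonneg (by positivity) (by positivity)).1 h12
  rw [norm_eq_zero.1 h3, smul_zero, add_zero] at h1 h2
  exact ⟨((frobNorm_stationarity grad γ x y θ).trans h1).le,
    ((frobNorm_stationarity grad γ y x θ).trans h2).le, ((vecNorm_residual b x y).trans h3).le⟩

lemma tripDist_euclMat_le (p q : EuclideanSpace ℝ (Fin n × Fin r) ×
      EuclideanSpace ℝ (Fin n × Fin r) × EuclideanSpace ℝ (Fin m)) :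
    tripDist (euclMat (Fin n) (Fin r) p.1, euclMat (Fin n) (Fin r) p.2.1, p.2.2.ofLp)
      (euclMat (Fin n) (Fin r) q.1, euclMat (Fin n) (Fin r) q.2.1, q.2.2.ofLp)
      ≤ 2 * dist p q := by
  have h1 : frobNorm (euclMat (Fin n) (Fin r) p.1 - euclMat (Fin n) (Fin r) q.1) ≤ dist p q := by
    rw [← map_sub, frobNorm_euclMat, ← dist_eq_norm]
    exact le_max_left _ _
  have h2 : frobNorm (euclMat (Fin n) (Fin r) p.2.1 - euclMat (Fin n) (Fin r) q.2.1)
      ≤ dist p q := by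
    rw [← map_sub, frobNorm_euclMat, ← dist_eq_norm]
    exact (le_max_left _ _).trans (le_max_right _ _)
  have h3 : vecNorm (fun i => p.2.2 i - q.2.2 i) ≤ dist p q := by
    refine (vecNorm_ofLp (p.2.2 - q.2.2)).trans_le ?_
    rw [← dist_eq_norm]
    exact (le_max_right _ _).trans (le_max_right _ _)
  refine Real.sqrt_le_iff.2 ⟨by positivity, ?_⟩
  have h1' := pow_le_pow_left₀ (frobNorm_nonneg _) h1 2
  have h2' := pow_le_pow_left₀ (frobNorm_nonneg _) h2 2
  have h3' := pow_le_pow_left₀ (vecNorm_nonneg _) h3 2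
  nlinarith [sq_nonneg (dist p q)]

end Problem

/-- Theorem 3.2(iii): sublinear convergence of the distance to the KKT set
when the Łojasiewicz inequality holds with exponent α ∈ (1/2, 1). -/
theorem admm_sublinear_convergence
    (n m r : ℕ) (hn : 0 < n) (hm : 0 < m) (hr : 0 < r)
    (f : Matrix (Fin n) (Fin n) ℝ → ℝ)
    (hconv : ConvexOn ℝ Set.univ f)
    (hsym : ∀ X : Matrix (Fin n) (Fin n) ℝ, f Xᵀ = f X)
    (grad : Matrix (Fin n) (Fin n) ℝ → Matrix (Fin n) (Fin n) ℝ)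
    (hgrad : ∀ X H : Matrix (Fin n) (Fin n) ℝ,
      HasDerivAt (fun t : ℝ => f (X + t • H)) (frobInner (grad X) H) 0)
    (hgradCont : Continuous grad)
    (hess : Matrix (Fin n) (Fin n) ℝ → Matrix (Fin n) (Fin n) ℝ → Matrix (Fin n) (Fin n) ℝ)
    (hhess : ∀ X H : Matrix (Fin n) (Fin n) ℝ, ∀ i j,
      HasDerivAt (fun t : ℝ => grad (X + t • H) i j) (hess X H i j) 0)
    (hgradLipCompact : ∀ s : Set (Matrix (Fin n) (Fin n) ℝ), IsCompact s → Convex ℝ s →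
      ∃ K : ℝ, ∀ X ∈ s, ∀ Y ∈ s, frobNorm (grad X - grad Y) ≤ K * frobNorm (X - Y))
    (hhessLipCompact : ∀ s : Set (Matrix (Fin n) (Fin n) ℝ), IsCompact s → Convex ℝ s →
      ∃ K : ℝ, ∀ X ∈ s, ∀ Y ∈ s, ∀ H : Matrix (Fin n) (Fin n) ℝ,
        frobNorm (hess X H - hess Y H) ≤ K * frobNorm H * frobNorm (X - Y))
    (A : Fin m → Matrix (Fin n) (Fin n) ℝ) (hAsym : ∀ i, (A i)ᵀ = A i)
    (b : Fin m → ℝ)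
    (hfeas : ∃ Uf Vf : Matrix (Fin n) (Fin r) ℝ, ∀ i, Aop A (Uf * Vfᵀ) i = b i)
    (hWne : (KKTset r grad A b γ).Nonempty)
    (ρ γ ρ₀ : ℝ) (hρpos : 0 < ρ) (hγpos : 0 < γ) (hρ₀pos : 0 < ρ₀)
    (U V : ℕ → Matrix (Fin n) (Fin r) ℝ) (lam : ℕ → Fin m → ℝ)
    (hUmin : ∀ k : ℕ, ∀ U' : Matrix (Fin n) (Fin r) ℝ,
      augL f A b ρ γ (U (k + 1)) (V k) (lam k) ≤ augL f A b ρ γ U' (V k) (lam k))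
    (hVmin : ∀ k : ℕ, ∀ V' : Matrix (Fin n) (Fin r) ℝ,
      augL f A b ρ γ (U (k + 1)) (V (k + 1)) (lam k) ≤ augL f A b ρ γ (U (k + 1)) V' (lam k))
    (hlamUpd : ∀ k : ℕ,
      lam (k + 1) = fun i => lam k i + ρ * (Aop A (U (k + 1) * (V (k + 1))ᵀ) i - b i))
    (hlevel : ∀ β : ℝ, IsCompact (Sset (r := r) f A b ρ₀ β) ∨ Sset (r := r) f A b ρ₀ β = ∅)
    (β0 βhat : ℝ) (hββ : β0 < βhat)
    (hinit : augL f A b ρ γ (U 0) (V 0) (lam 0) + 1 / ρ * (vecNorm (lam 0)) ^ 2 ≤ β0)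
    (δ : ℝ) (hδpos : 0 < δ)
    (hδB : ∀ p ∈ Sset (r := r) f A b ρ₀ βhat, frobNorm p.1 ≤ δ ∧ frobNorm p.2 ≤ δ)
    (Lf L : ℝ) (hLfpos : 0 < Lf) (hLpos : 0 < L)
    (hgradB : ∀ X : Matrix (Fin n) (Fin n) ℝ, frobNorm X ≤ δ ^ 2 → frobNorm (grad X) ≤ Lf)
    (hgradLip : ∀ X Y : Matrix (Fin n) (Fin n) ℝ, frobNorm X ≤ δ ^ 2 → frobNorm Y ≤ δ ^ 2 →
      frobNorm (grad X - grad Y) ≤ L * frobNorm (X - Y))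
    (η : ℝ) (hηpos : 0 < η)
    (hηB : ∀ p ∈ Sset (r := r) f A b ρ₀ βhat, η ≤ sigmaMin (Cmat A p.1))
    (c₁ c₂ : ℝ)
    (hc₁ : c₁ = 2 / η ^ 2 * (L * δ ^ 2 + Lf + γ + 1 / η * Lf * δ * Real.sqrt (sA A)
      + 2 / η * γ * δ * Real.sqrt (sA A)) ^ 2)
    (hc₂ : c₂ = 2 / η ^ 2 * (L * δ ^ 2 + γ) ^ 2)
    (hγρ₀ : ρ₀ < γ)
    (hρbig : max (max (2 * ρ₀) (2 * c₁ / γ))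
      (max (2 * c₂ / γ) (((Lf * δ + 2 * γ * δ) / η) ^ 2 / (βhat - β0))) < ρ)
    (α : ℝ) (hα0 : 1 / 2 < α) (hα1 : α < 1)
    (hLoj : ∃ c δc : ℝ, 0 < c ∧ 0 < δc ∧
      ∀ p q : Matrix (Fin n) (Fin r) ℝ × Matrix (Fin n) (Fin r) ℝ × (Fin m → ℝ),
        q ∈ KKTset r grad A b γ → tripDist p q ≤ δc →
        |augL f A b ρ γ p.1 p.2.1 p.2.2 - augL f A b ρ γ q.1 q.2.1 q.2.2| ^ α
          ≤ c * gradAugLNorm grad A b ρ γ p.1 p.2.1 p.2.2)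
    :
    ∃ (k₀ : ℕ) (ξ : ℝ), 0 < ξ ∧ ∀ k : ℕ, k₀ < k →
      sInf (tripDist (U k, V k, lam k) '' KKTset r grad A b γ)
        ≤ ξ * ((k : ℝ) - (k₀ : ℝ)) ^ (-(1 - α) / (2 * α - 1)) := by
  obtain ⟨⟨hρ₀ρ, hρc₁⟩, -, hρβ⟩ : (2 * ρ₀ < ρ ∧ 2 * c₁ / γ < ρ) ∧ 2 * c₂ / γ < ρ ∧
      ((Lf * δ + 2 * γ * δ) / η) ^ 2 / (βhat - β0) < ρ := by
    simpa only [max_lt_iff] using hρbig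
  have hrate : 4 * (L * δ ^ 2 + Lf + γ + √(sA A) * ((Lf + 2 * γ) * δ / η)) ^ 2
      < ρ * γ * η ^ 2 := by
    rw [div_lt_iff₀ hγpos, hc₁] at hρc₁
    have h := mul_lt_mul_of_pos_right hρc₁ (pow_pos hηpos 2)
    refine lt_of_eq_of_lt ?_ h
    field_simp
    ring
  have hmult : ((Lf + 2 * γ) * δ / η) ^ 2 / ρ < βhat - β0 := by
    rw [div_lt_iff₀ (sub_pos.2 hββ)] at hρβ
    rw [div_lt_iff₀ hρpos, add_mul]
    linarith
  set P := matrixProblem hconv hsym hgrad hgradCont hAsym b hρpos hγpos hρ₀pos hδpos hLfpos hLpos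
    hηpos hγρ₀ hρ₀ρ hlevel hδB hgradB hgradLip hηB hrate hmult
  have hlag : ∀ x y θ, P.lag x y θ
      = augL f A b ρ γ (euclMat (Fin n) (Fin r) x) (euclMat (Fin n) (Fin r) y) θ.ofLp :=
    fun x y θ => (augL_euclMat f b ρ γ x y θ).symm
  have hmem : ∀ z, P.gradSum z = 0 →
      (euclMat (Fin n) (Fin r) z.1, euclMat (Fin n) (Fin r) z.2.1, z.2.2.ofLp)
        ∈ KKTset r grad A b γ :=
    fun z hz => mem_KKTset_euclMat (ρ := ρ) hz
  have : NeZero m := ⟨hm.ne'⟩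
  obtain ⟨c, δc, hc, hδc, hKL⟩ := hLoj
  obtain ⟨k₀, ξ, hξ, h⟩ := P.exists_dist_le (U := fun k => (euclMat (Fin n) (Fin r)).symm (U k))
    (V := fun k => (euclMat (Fin n) (Fin r)).symm (V k)) (lam := fun k => WithLp.toLp 2 (lam k))
    (fun k => ⟨fun x => by
        rw [hlag, hlag, LinearEquiv.apply_symm_apply, LinearEquiv.apply_symm_apply]
        exact hUmin k _,
      fun y => by
        rw [hlag, hlag, LinearEquiv.apply_symm_apply, LinearEquiv.apply_symm_apply]
        exact hVmin k _, by
        ext i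
        exact congrFun (hlamUpd k) i⟩)
    (by
      rw [hlag, LinearEquiv.apply_symm_apply, LinearEquiv.apply_symm_apply, ← vecNorm_ofLp]
      exact hinit)
    hα0 hα1 hc (half_pos hδc) (fun x y hy hxy => by
      rw [hlag, hlag]
      refine (hKL (euclMat (Fin n) (Fin r) x.1, euclMat (Fin n) (Fin r) x.2.1, x.2.2.ofLp) _
        (hmem y hy) ((tripDist_euclMat_le x y).trans (by linarith))).trans
        (mul_le_mul_of_nonneg_left ?_ hc.le)
      exact gradAugLNorm_euclMat_le grad b ρ γ x.1 x.2.1 x.2.2)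
  refine ⟨k₀, 2 * ξ, by positivity, fun k hk => ?_⟩
  obtain ⟨y, hy, hky⟩ := h k hk
  refine (csInf_le ⟨0, ?_⟩ (Set.mem_image_of_mem _ (hmem y hy))).trans ?_
  · rintro _ ⟨q, -, rfl⟩
    exact Real.sqrt_nonneg _
  · have hle := tripDist_euclMat_le ((euclMat (Fin n) (Fin r)).symm (U k),
      (euclMat (Fin n) (Fin r)).symm (V k), WithLp.toLp 2 (lam k)) y
    rw [LinearEquiv.apply_symm_apply, LinearEquiv.apply_symm_apply] at hle
    rw [mul_assoc]
    exact hle.trans (mul_le_mul_of_nonneg_left hky two_pos.le)
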